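/- arXiv:1705.00293 — 2 statements merged into one kernel-verified Lean document; each statement's English description precedes it below -/
import Mathlib

section
/- There exists a 4-regular matchstick graph with exactly 68 vertices. -/
open scoped Classical

/-- A matchstick graph: a finite set of points in the Euclidean plane together with
a finite set of unit-length non-crossing straight edges between distinct points. -/
structure MatchstickGraph where
  V : Finset (EuclideanSpace ℝ (Fin 2))
  E : Finset (Sym2 (EuclideanSpace ℝ (Fin 2)))
  edge_mem : ∀ e ∈ E, ∀ u v : EuclideanSpace ℝ (Fin 2), e = s(u, v) → u ∈ V ∧ v ∈ V
  edge_ne : ∀ e ∈ E, ¬ e.IsDiag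
  edge_unit : ∀ e ∈ E, ∀ u v : EuclideanSpace ℝ (Fin 2), e = s(u, v) → dist u v = 1
  noncross : ∀ e₁ ∈ E, ∀ e₂ ∈ E, e₁ ≠ e₂ →
    ∀ u v x y : EuclideanSpace ℝ (Fin 2), e₁ = s(u, v) → e₂ = s(x, y) →
      segment ℝ u v ∩ segment ℝ x y ⊆ (({u, v} : Set (EuclideanSpace ℝ (Fin 2))) ∩ {x, y})

/-- The degree of a vertex: the number of edges containing it. -/
noncomputable def MatchstickGraph.degree (G : MatchstickGraph)
    (v : EuclideanSpace ℝ (Fin 2)) : ℕ :=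
  (G.E.filter (fun e => v ∈ e)).card

/-- A matchstick graph is 4-regular if every vertex has degree 4. -/
def MatchstickGraph.IsFourRegular (G : MatchstickGraph) : Prop :=
  ∀ v ∈ G.V, G.degree v = 4

/-- A matchstick graph is (2,4)-regular if every vertex has degree 2 or degree 4. -/
def MatchstickGraph.IsTwoFourRegular (G : MatchstickGraph) : Prop :=
  ∀ v ∈ G.V, G.degree v = 2 ∨ G.degree v = 4

/-- Abscissa of the second intersection of the `x`-axis with the unit circle around the lower end
of the strip. -/
noncomputable def footX (c s : ℝ) : ℝ := 3 * s + 2 * c - √3 * s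

/-- With `k = c - √3 s`, the two outer ends of the inner rhombus have squared distance
`1 + 2 k ^ 2`, and their common unit neighbour lies at height `linkHeight` over their midpoint,
measured in units of that distance. -/
noncomputable def linkHeight (c s : ℝ) : ℝ :=
  √((3 - 2 * (c - √3 * s) ^ 2) / (4 * (1 + 2 * (c - √3 * s) ^ 2)))

noncomputable def linkX (c s : ℝ) : ℝ :=
  (6 * s + 5 / 2 * c - 3 / 2 * (√3 * s)) / 2 + (√3 * c - 5 * s) / 2 * linkHeight c s

noncomputable def linkY (c s : ℝ) : ℝ :=
  (5 * s - √3 * c) / 4 - (3 * c - √3 * s) / 2 * linkHeight c s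

/-- Vanishes exactly when the third corner of the inner equilateral triangle lies on the
diagonal. -/
noncomputable def diagonalDefect (c s : ℝ) : ℝ :=
  linkX c s + (linkX c s - footX c s - linkY c s) * (1 + √3) / 2

lemma sqrt_three_mem : 1.73205 < √3 ∧ √3 < 1.73206 :=
  ⟨Real.lt_sqrt_of_sq_lt (by norm_num), (Real.sqrt_lt' (by norm_num)).2 (by norm_num)⟩

lemma abs_mul_sub_le {a b a₀ b₀ α β : ℝ} (ha : |a - a₀| ≤ α) (hb : |b - b₀| ≤ β) :
    |a * b - a₀ * b₀| ≤ |a₀| * β + |b₀| * α + α * β := by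
  have h : a * b - a₀ * b₀ = a₀ * (b - b₀) + b₀ * (a - a₀) + (a - a₀) * (b - b₀) := by ring
  rw [h]
  refine (abs_add_three _ _ _).trans ?_
  rw [abs_mul, abs_mul, abs_mul]
  have := (abs_nonneg _).trans ha
  gcongr

lemma abs_sqrt_three_sub : |√3 - 1.73205| ≤ 0.00001 := by
  have := sqrt_three_mem
  rw [abs_le]; constructor <;> linarith

/-- Bounds for the apex of the linkage, near a configuration with `c - √3 s = k₀`. -/
lemma abs_linkHeight_sub_le {c s k₀ κ q₀ η : ℝ} (hk : |c - √3 * s - k₀| ≤ κ)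
    (hq : 0 ≤ q₀ - η)
    (hlo : ∀ w : ℝ, |w - k₀ * k₀| ≤ 2 * |k₀| * κ + κ * κ →
      (q₀ - η) ^ 2 * (4 * (1 + 2 * w)) ≤ 3 - 2 * w)
    (hhi : ∀ w : ℝ, |w - k₀ * k₀| ≤ 2 * |k₀| * κ + κ * κ →
      3 - 2 * w ≤ (q₀ + η) ^ 2 * (4 * (1 + 2 * w)))
    (hη : 0 ≤ η) :
    |linkHeight c s - q₀| ≤ η := by
  have h := abs_mul_sub_le hk hk
  have h' : |(c - √3 * s) * (c - √3 * s) - k₀ * k₀| ≤ 2 * |k₀| * κ + κ * κ := by linarith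
  have h1 := hlo _ h'
  have h2 := hhi _ h'
  rw [← pow_two] at h1 h2
  have hpos : 0 < 4 * (1 + 2 * (c - √3 * s) ^ 2) := by positivity
  rw [abs_le, linkHeight]
  constructor
  · have : q₀ - η ≤ √((3 - 2 * (c - √3 * s) ^ 2) / (4 * (1 + 2 * (c - √3 * s) ^ 2))) :=
      Real.le_sqrt_of_sq_le ((le_div_iff₀ hpos).2 h1)
    linarith
  · have : √((3 - 2 * (c - √3 * s) ^ 2) / (4 * (1 + 2 * (c - √3 * s) ^ 2))) ≤ q₀ + η :=
      Real.sqrt_le_iff.2 ⟨by linarith, (div_le_iff₀ hpos).2 h2⟩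
    linarith

lemma diagonalDefect_neg : diagonalDefect (153279 / 346721) (311000 / 346721) < 0 := by
  have hr := sqrt_three_mem
  have hk : |(153279 / 346721 : ℝ) - √3 * (311000 / 346721) - (-1.11152)| ≤ 0.00002 := by
    rw [abs_le]; constructor <;> linarith
  have hq : |linkHeight (153279 / 346721) (311000 / 346721) - 0.1952| ≤ 0.0001 := by
    refine abs_linkHeight_sub_le hk (by norm_num) ?_ ?_ (by norm_num) <;>
    · intro w hw
      norm_num [abs_le] at hw ⊢
      linarith [hw.1, hw.2]
  have hx : |(√3 * (153279 / 346721) - 5 * (311000 / 346721)) / 2 - (-1.85958)| ≤ 0.0001 := by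
    rw [abs_le]; constructor <;> linarith
  have hy : |(3 * (153279 / 346721) - √3 * (311000 / 346721)) / 2 - (-0.11368)| ≤ 0.0001 := by
    rw [abs_le]; constructor <;> linarith
  have hxq := abs_mul_sub_le hx hq
  have hyq := abs_mul_sub_le hy hq
  have hX : |linkX (153279 / 346721) (311000 / 346721) - 1.7153| ≤ 0.0004 := by
    norm_num [abs_le] at hxq ⊢
    rw [linkX]
    constructor <;> linarith [hxq.1, hxq.2]
  have hZ : |linkX (153279 / 346721) (311000 / 346721) - footX (153279 / 346721) (311000 / 346721)
      - linkY (153279 / 346721) (311000 / 346721) - (-1.2581)| ≤ 0.0008 := by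
    norm_num [abs_le] at hX hyq ⊢
    rw [linkY, footX]
    constructor <;> linarith [hX.1, hX.2, hyq.1, hyq.2]
  have hg := abs_mul_sub_le hZ abs_sqrt_three_sub
  norm_num [abs_le] at hX hZ hg
  rw [diagonalDefect]
  linarith [hX.2, hZ.2, hg.2]

lemma diagonalDefect_pos : 0 < diagonalDefect (611871 / 1388129) (1246000 / 1388129) := by
  have hr := sqrt_three_mem
  have hk : |(611871 / 1388129 : ℝ) - √3 * (1246000 / 1388129) - (-1.11392)| ≤ 0.00002 := by
    rw [abs_le]; constructor <;> linarith
  have hq : |linkHeight (611871 / 1388129) (1246000 / 1388129) - 0.19293| ≤ 0.0001 := by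
    refine abs_linkHeight_sub_le hk (by norm_num) ?_ ?_ (by norm_num) <;>
    · intro w hw
      norm_num [abs_le] at hw ⊢
      linarith [hw.1, hw.2]
  have hx : |(√3 * (611871 / 1388129) - 5 * (1246000 / 1388129)) / 2 - (-1.86229)| ≤ 0.0001 := by
    rw [abs_le]; constructor <;> linarith
  have hy : |(3 * (611871 / 1388129) - √3 * (1246000 / 1388129)) / 2 - (-0.11617)| ≤ 0.0001 := by
    rw [abs_le]; constructor <;> linarith
  have hxq := abs_mul_sub_le hx hq
  have hyq := abs_mul_sub_le hy hq
  have hX : |linkX (611871 / 1388129) (1246000 / 1388129) - 1.7185| ≤ 0.0004 := by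
    norm_num [abs_le] at hxq ⊢
    rw [linkX]
    constructor <;> linarith [hxq.1, hxq.2]
  have hZ : |linkX (611871 / 1388129) (1246000 / 1388129) -
      footX (611871 / 1388129) (1246000 / 1388129) -
      linkY (611871 / 1388129) (1246000 / 1388129) - (-1.25476)| ≤ 0.0008 := by
    norm_num [abs_le] at hX hyq ⊢
    rw [linkY, footX]
    constructor <;> linarith [hX.1, hX.2, hyq.1, hyq.2]
  have hg := abs_mul_sub_le hZ abs_sqrt_three_sub
  norm_num [abs_le] at hX hZ hg
  rw [diagonalDefect]
  linarith [hX.1, hZ.1, hg.1]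

/-- A direction on the unit circle for which the linkage closes up. -/
lemma exists_diagonalDefect_eq_zero :
    ∃ c s : ℝ, c ^ 2 + s ^ 2 = 1 ∧ |c - 0.44143| ≤ 0.0007 ∧ |s - 0.8973| ≤ 0.0004 ∧
      diagonalDefect c s = 0 := by
  let c : ℝ → ℝ := fun t ↦ (1 - t ^ 2) / (1 + t ^ 2)
  let s : ℝ → ℝ := fun t ↦ 2 * t / (1 + t ^ 2)
  have hne : ∀ t : ℝ, 1 + t ^ 2 ≠ 0 := fun t ↦ by positivity
  have hc : Continuous c := by fun_prop (disch := exact hne _)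
  have hs : Continuous s := by fun_prop (disch := exact hne _)
  have hq : Continuous fun t ↦ linkHeight (c t) (s t) := by
    unfold linkHeight
    refine Real.continuous_sqrt.comp (Continuous.div (by fun_prop) (by fun_prop) ?_)
    intro t; positivity
  have hg : Continuous fun t ↦ diagonalDefect (c t) (s t) := by
    unfold diagonalDefect linkX linkY footX
    fun_prop
  have hlo : diagonalDefect (c 0.622) (s 0.622) ≤ 0 := by
    rw [show c 0.622 = 153279 / 346721 by norm_num [c],
      show s 0.622 = 311000 / 346721 by norm_num [s]]
    exact diagonalDefect_neg.le
  have hhi : 0 ≤ diagonalDefect (c 0.623) (s 0.623) := by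
    rw [show c 0.623 = 611871 / 1388129 by norm_num [c],
      show s 0.623 = 1246000 / 1388129 by norm_num [s]]
    exact diagonalDefect_pos.le
  obtain ⟨t, ht, h0⟩ := intermediate_value_Icc (by norm_num) hg.continuousOn ⟨hlo, hhi⟩
  have h1 : 0 < 1 + t ^ 2 := by positivity
  refine ⟨c t, s t, ?_, ?_, ?_, h0⟩
  · simp only [c, s]; field_simp; ring
  · obtain ⟨ha, hb⟩ := ht
    rw [abs_sub_le_iff, sub_le_iff_le_add, sub_le_comm, div_le_iff₀ h1, le_div_iff₀ h1]
    constructor <;> norm_num at ha hb ⊢ <;> nlinarith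
  · obtain ⟨ha, hb⟩ := ht
    rw [abs_sub_le_iff, sub_le_iff_le_add, sub_le_comm, div_le_iff₀ h1, le_div_iff₀ h1]
    constructor <;> norm_num at ha hb ⊢ <;> nlinarith

/-- Squared distance in coordinates. -/
def sqDist {R : Type*} [Ring R] (p q : R × R) : R := (p.1 - q.1) ^ 2 + (p.2 - q.2) ^ 2

/-- The edges of the graph up to the symmetries of the square. -/
def baseEdge : Fin 17 → Fin 11 × Fin 11 :=
  ![(0, 1), (0, 6), (0, 7), (0, 8), (1, 3), (1, 4), (1, 9), (2, 6), (7, 8), (2, 4), (2, 5),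
    (2, 10), (3, 4), (3, 9), (3, 5), (4, 5), (5, 10)]

/-- Approximate coordinates, in thousandths, of the vertices up to the symmetries of the square. -/
def approx : Fin 11 → ℤ × ℤ :=
  ![(1717, 953), (2135, 1861), (3019, 66), (3133, 1794), (2577, 963), (3575, 897), (2021, 0),
    (1413, 0), (740, 740), (2692, 2692), (4016, 0)]

/-- `p` has coordinates `a / 1000` up to an error of `1 / 50`. -/
def IsNear (p : ℝ × ℝ) (a : ℤ × ℤ) : Prop :=
  |1000 * p.1 - a.1| ≤ 20 ∧ |1000 * p.2 - a.2| ≤ 20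

/-- The vertices `6, 7, 10` lie on the `x`-axis and the vertices `8, 9` on the diagonal. -/
def OnAxes (p : Fin 11 → ℝ × ℝ) : Prop :=
  (p 6).2 = 0 ∧ (p 7).2 = 0 ∧ (p 8).1 = (p 8).2 ∧ (p 9).1 = (p 9).2 ∧ (p 10).2 = 0

lemma linkHeight_sq {c s : ℝ} (h : 0 ≤ 3 - 2 * (c - √3 * s) ^ 2) :
    linkHeight c s ^ 2 * (4 * (1 + 2 * (c - √3 * s) ^ 2)) = 3 - 2 * (c - √3 * s) ^ 2 := by
  rw [linkHeight, Real.sq_sqrt (by positivity), div_mul_cancel₀ _ (by positivity)]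

/-- A closing direction, with estimates for the linkage that it determines. -/
lemma exists_linkage :
    ∃ c s : ℝ, c ^ 2 + s ^ 2 = 1 ∧ diagonalDefect c s = 0 ∧
      linkHeight c s ^ 2 * (4 * (1 + 2 * (c - √3 * s) ^ 2)) = 3 - 2 * (c - √3 * s) ^ 2 ∧
      |c - 0.44143| ≤ 0.0007 ∧ |s - 0.8973| ≤ 0.0004 ∧ |linkX c s - 1.717| ≤ 0.0075 ∧
      |linkY c s - 0.953| ≤ 0.004 ∧ |footX c s - 2.0207| ≤ 0.0035 ∧
      |(linkY c s - √3 * (linkX c s - footX c s)) / 2 - 0.74| ≤ 0.015 := by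
  obtain ⟨c, s, hcs, hc, hs, hgap⟩ := exists_diagonalDefect_eq_zero
  have hrs := abs_mul_sub_le abs_sqrt_three_sub hs
  have hrc := abs_mul_sub_le abs_sqrt_three_sub hc
  have hk : |c - √3 * s - (-1.11274)| ≤ 0.0015 := by
    norm_num [abs_le] at hc hrs ⊢
    constructor <;> linarith [hc.1, hc.2, hrs.1, hrs.2]
  have hq : |linkHeight c s - 0.1941| ≤ 0.002 := by
    refine abs_linkHeight_sub_le hk (by norm_num) ?_ ?_ (by norm_num) <;>
    · intro w hw
      norm_num [abs_le] at hw ⊢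
      linarith [hw.1, hw.2]
  have hkk := abs_mul_sub_le hk hk
  have hq2 : linkHeight c s ^ 2 * (4 * (1 + 2 * (c - √3 * s) ^ 2)) = 3 - 2 * (c - √3 * s) ^ 2 := by
    apply linkHeight_sq
    norm_num [abs_le] at hkk
    linarith [hkk.2]
  have hxq : |(√3 * c - 5 * s) / 2 * linkHeight c s - (-0.36122)| ≤ 0.0042 := by
    have h : |(√3 * c - 5 * s) / 2 - (-1.861)| ≤ 0.002 := by
      norm_num [abs_le] at hs hrc ⊢
      constructor <;> linarith [hs.1, hs.2, hrc.1, hrc.2]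
    have := abs_mul_sub_le h hq
    norm_num [abs_le] at this ⊢
    constructor <;> linarith [this.1, this.2]
  have hyq : |(3 * c - √3 * s) / 2 * linkHeight c s - (-0.0223)| ≤ 0.002 := by
    have h : |(3 * c - √3 * s) / 2 - (-0.115)| ≤ 0.002 := by
      norm_num [abs_le] at hc hrs ⊢
      constructor <;> linarith [hc.1, hc.2, hrs.1, hrs.2]
    have := abs_mul_sub_le h hq
    norm_num [abs_le] at this ⊢
    constructor <;> linarith [this.1, this.2]
  have hX : |linkX c s - 1.717| ≤ 0.0075 := by
    norm_num [abs_le] at hc hs hrs hxq ⊢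
    rw [linkX]
    constructor <;> linarith [hc.1, hc.2, hs.1, hs.2, hrs.1, hrs.2, hxq.1, hxq.2]
  have hY : |linkY c s - 0.953| ≤ 0.004 := by
    norm_num [abs_le] at hc hs hrc hyq ⊢
    rw [linkY]
    constructor <;> linarith [hc.1, hc.2, hs.1, hs.2, hrc.1, hrc.2, hyq.1, hyq.2]
  have hF : |footX c s - 2.0207| ≤ 0.0035 := by
    norm_num [abs_le] at hc hs hrs ⊢
    rw [footX]
    constructor <;> linarith [hc.1, hc.2, hs.1, hs.2, hrs.1, hrs.2]
  have hZ : |(linkY c s - √3 * (linkX c s - footX c s)) / 2 - 0.74| ≤ 0.015 := by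
    have h : |linkX c s - footX c s - (-0.304)| ≤ 0.0115 := by
      norm_num [abs_le] at hX hF ⊢
      constructor <;> linarith [hX.1, hX.2, hF.1, hF.2]
    have := abs_mul_sub_le abs_sqrt_three_sub h
    norm_num [abs_le] at this hY ⊢
    constructor <;> linarith [this.1, this.2, hY.1, hY.2]
  exact ⟨c, s, hcs, hgap, hq2, hc, hs, hX, hY, hF, hZ⟩

/-- The vertices up to the symmetries of the square, for a given direction `(c, s)`. -/
noncomputable def basePoint (c s : ℝ) : Fin 11 → ℝ × ℝ := ![
    (linkX c s, linkY c s),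
    (3 * s + (c - √3 * s) / 2, (5 * s - √3 * c) / 2),
    (3 * s + 2 * c + (c - √3 * s) / 2, (s - √3 * c) / 2),
    (3 * s + c, 2 * s),
    (3 * s + c + (c - √3 * s) / 2, (3 * s - √3 * c) / 2),
    (3 * s + 2 * c, s),
    (footX c s, 0),
    (2 * linkX c s - footX c s, 0),
    ((linkY c s - √3 * (linkX c s - footX c s)) / 2,
      (linkY c s - √3 * (linkX c s - footX c s)) / 2),
    (3 * s, 3 * s),
    (3 * s + 3 * c, 0)]

lemma sqDist_basePoint {c s : ℝ} (hcs : c ^ 2 + s ^ 2 = 1) (hgap : diagonalDefect c s = 0)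
    (hq : linkHeight c s ^ 2 * (4 * (1 + 2 * (c - √3 * s) ^ 2)) = 3 - 2 * (c - √3 * s) ^ 2)
    (e : Fin 17) :
    sqDist (basePoint c s (baseEdge e).1) (basePoint c s (baseEdge e).2) = 1 := by
  have h3 : √3 ^ 2 = 3 := Real.sq_sqrt (by norm_num)
  have hlink₁ : sqDist (basePoint c s 0) (basePoint c s 1) = 1 := by
    simp only [sqDist, basePoint, linkX, linkY, Matrix.cons_val]
    grind
  have hlink₂ : sqDist (basePoint c s 0) (basePoint c s 6) = 1 := by
    simp only [sqDist, basePoint, linkX, linkY, footX, Matrix.cons_val]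
    grind
  have hlink₃ : sqDist (basePoint c s 0) (basePoint c s 8) = 1 := by
    simp only [sqDist, basePoint, Matrix.cons_val, diagonalDefect] at hlink₂ hgap ⊢
    grind
  have hlink₄ : sqDist (basePoint c s 7) (basePoint c s 8) = 1 := by
    simp only [sqDist, basePoint, Matrix.cons_val, diagonalDefect] at hlink₂ hgap ⊢
    grind
  fin_cases e
  · exact hlink₁
  · exact hlink₂
  · simp only [sqDist, basePoint, Matrix.cons_val] at hlink₂ ⊢
    simp [baseEdge]
    linarith
  · exact hlink₃
  all_goals first
    | exact hlink₄
    | simp [sqDist, baseEdge, basePoint, footX]; grind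

lemma isNear_basePoint {c s : ℝ} (hc : |c - 0.44143| ≤ 0.0007) (hs : |s - 0.8973| ≤ 0.0004)
    (hX : |linkX c s - 1.717| ≤ 0.0075) (hY : |linkY c s - 0.953| ≤ 0.004)
    (hF : |footX c s - 2.0207| ≤ 0.0035)
    (hZ : |(linkY c s - √3 * (linkX c s - footX c s)) / 2 - 0.74| ≤ 0.015) (w : Fin 11) :
    IsNear (basePoint c s w) (approx w) := by
  have hrs := abs_mul_sub_le abs_sqrt_three_sub hs
  have hrc := abs_mul_sub_le abs_sqrt_three_sub hc
  norm_num [abs_le] at hc hs hrs hrc hX hY hF hZ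
  fin_cases w <;> simp [IsNear, approx, basePoint, abs_le] <;>
    (repeat' apply And.intro) <;>
    linarith [hc.1, hc.2, hs.1, hs.2, hrs.1, hrs.2, hrc.1, hrc.2, hX.1, hX.2, hY.1, hY.2, hF.1,
      hF.2, hZ.1, hZ.2]

lemma exists_base_points :
    ∃ p : Fin 11 → ℝ × ℝ, OnAxes p ∧ (∀ e, sqDist (p (baseEdge e).1) (p (baseEdge e).2) = 1) ∧
      ∀ w, IsNear (p w) (approx w) := by
  obtain ⟨c, s, hcs, hgap, hq, hc, hs, hX, hY, hF, hZ⟩ := exists_linkage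
  exact ⟨basePoint c s, by simp [OnAxes, basePoint], sqDist_basePoint hcs hgap hq,
    isNear_basePoint hc hs hX hY hF hZ⟩

/-- The symmetries of the square: `o % 4` quarter turns, after a reflection in the `x`-axis
if `4 ≤ o`. -/
def squareSymm {R : Type*} [Neg R] (o : ℕ) (p : R × R) : R × R :=
  (fun q ↦ (-q.2, q.1))^[o % 4] (if o < 4 then p else (p.1, -p.2))

lemma sqDist_squareSymm (o : ℕ) (p q : ℝ × ℝ) :
    sqDist (squareSymm o p) (squareSymm o q) = sqDist p q := by
  have h (n : ℕ) (p q : ℝ × ℝ) : sqDist ((fun q ↦ (-q.2, q.1))^[n] p)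
      ((fun q ↦ (-q.2, q.1))^[n] q) = sqDist p q := by
    induction n generalizing p q with
    | zero => rfl
    | succ n ih => rw [Function.iterate_succ_apply, Function.iterate_succ_apply, ih]
                   simp only [sqDist]; ring
  rw [squareSymm, squareSymm, h]
  split_ifs
  · rfl
  · simp only [sqDist]; ring

lemma IsNear.squareSymm {p : ℝ × ℝ} {a : ℤ × ℤ} (h : IsNear p a) (o : ℕ) :
    IsNear (squareSymm o p) (squareSymm o a) := by
  have neg_near {x : ℝ} {m : ℤ} (h : |1000 * x - m| ≤ 20) :
      |1000 * (-x) - ((-m : ℤ) : ℝ)| ≤ 20 := by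
    rw [← abs_neg]; push_cast; convert h using 2; ring
  have iter (n : ℕ) (p : ℝ × ℝ) (a : ℤ × ℤ) (h : IsNear p a) :
      IsNear ((fun q ↦ (-q.2, q.1))^[n] p) ((fun q ↦ (-q.2, q.1))^[n] a) := by
    induction n generalizing p a with
    | zero => exact h
    | succ n ih => exact ih _ _ ⟨neg_near h.2, h.1⟩
  apply iter
  split_ifs
  · exact h
  · exact ⟨h.1, neg_near h.2⟩

/-- The orbit of the `i`-th vertex: six orbits of size eight, then five of size four. -/
def orbit (i : Fin 68) : Fin 11 := Fin.ofNat 11 (if i.val < 48 then i / 8 else (i - 24) / 4)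

/-- The symmetry taking the representative of its orbit to the `i`-th vertex. -/
def turn (i : Fin 68) : ℕ := if i.val < 48 then i % 8 else i % 4

/-- The coordinates of the `i`-th vertex, from those of the orbit representatives. -/
def place {R : Type*} [Neg R] (p : Fin 11 → R × R) (i : Fin 68) : R × R :=
  squareSymm (turn i) (p (orbit i))

/-- The number of the image of the `w`-th representative under the symmetry `o`. -/
def index (o : ℕ) (w : Fin 11) : Fin 68 :=
  Fin.ofNat 68 (if w < 6 then 8 * w + o else
    4 * w + 24 + if o < 4 then o else if w = 8 ∨ w = 9 then (o + 3) % 4 else o % 4)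

def source (k : Fin 136) : Fin 68 := index (k % 8) (baseEdge (Fin.ofNat 17 (k / 8))).1

def target (k : Fin 136) : Fin 68 := index (k % 8) (baseEdge (Fin.ofNat 17 (k / 8))).2

lemma place_index {p : Fin 11 → ℝ × ℝ} (hp : OnAxes p) {o : ℕ} (ho : o < 8) (w : Fin 11) :
    place p (index o w) = squareSymm o (p w) := by
  obtain ⟨h6, h7, h8, h9, h10⟩ := hp
  have horbit : ∀ w, ∀ o < 8, orbit (index o w) = w := by decide
  have hturn : ∀ w, ∀ o < 8, turn (index o w) = if w < 6 ∨ o < 4 then o else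
      if w = 8 ∨ w = 9 then (o + 3) % 4 else o % 4 := by decide
  rw [place, horbit w o ho, hturn w o ho]
  by_cases h : w < 6 ∨ o < 4
  · rw [if_pos h]
  · obtain ⟨hw, ho'⟩ := not_or.1 h
    rw [if_neg h]
    rw [not_lt] at ho' hw
    interval_cases o <;> fin_cases w <;> simp_all [squareSymm, Prod.ext_iff]

/-- The direction `n` separates the segments `ab` and `cd`, whatever points near `a, b, c, d` one
takes as their ends. -/
def separates (n a b c d : ℤ × ℤ) : Bool :=
  let f (q : ℤ × ℤ) : ℤ := n.1 * q.1 + n.2 * q.2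
  let m := 40 * (|n.1| + |n.2|)
  f a + m < f c && f a + m < f d && f b + m < f c && f b + m < f d

/-- One of the directions of, or orthogonal to, the segments `ab` and `cd` separates them. -/
def apart (a b c d : ℤ × ℤ) : Bool :=
  [b - a, d - c, squareSymm 1 (b - a), squareSymm 1 (d - c)].any fun n ↦
    separates n a b c d || separates n c d a b

/-- The point of the plane with given coordinates. -/
noncomputable def toPlane (p : ℝ × ℝ) : EuclideanSpace ℝ (Fin 2) := !₂[p.1, p.2]

lemma dist_toPlane (p q : ℝ × ℝ) : dist (toPlane p) (toPlane q) = √(sqDist p q) := by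
  simp [toPlane, sqDist, EuclideanSpace.dist_eq, Fin.sum_univ_two, Real.dist_eq, sq_abs]

lemma toPlane_injective : Function.Injective toPlane := fun p q h ↦
  Prod.ext (by simpa [toPlane] using congrArg (· 0) h) (by simpa [toPlane] using congrArg (· 1) h)

lemma disjoint_segment_of_separates {n a b c d : ℤ × ℤ} {p q x y : ℝ × ℝ}
    (h : separates n a b c d) (hp : IsNear p a) (hq : IsNear q b) (hx : IsNear x c)
    (hy : IsNear y d) :
    Disjoint (segment ℝ (toPlane p) (toPlane q)) (segment ℝ (toPlane x) (toPlane y)) := by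
  let f : EuclideanSpace ℝ (Fin 2) →ₗ[ℝ] ℝ :=
    (n.1 : ℝ) • (EuclideanSpace.proj 0).toLinearMap + (n.2 : ℝ) • (EuclideanSpace.proj 1).toLinearMap
  have hf (z : ℝ × ℝ) : f (toPlane z) = n.1 * z.1 + n.2 * z.2 := by simp [f, toPlane]
  have near {z : ℝ × ℝ} {e : ℤ × ℤ} (hz : IsNear z e) :
      |1000 * f (toPlane z) - (n.1 * e.1 + n.2 * e.2)| ≤ 20 * (|(n.1 : ℝ)| + |(n.2 : ℝ)|) := by
    have : 1000 * f (toPlane z) - (n.1 * e.1 + n.2 * e.2) =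
        n.1 * (1000 * z.1 - e.1) + n.2 * (1000 * z.2 - e.2) := by rw [hf]; ring
    rw [this]
    refine (abs_add_le _ _).trans ?_
    rw [abs_mul, abs_mul]
    nlinarith [mul_le_mul_of_nonneg_left hz.1 (abs_nonneg (n.1 : ℝ)),
      mul_le_mul_of_nonneg_left hz.2 (abs_nonneg (n.2 : ℝ))]
  have lt {z w : ℝ × ℝ} {e g : ℤ × ℤ} (hz : IsNear z e) (hw : IsNear w g)
      (h : n.1 * e.1 + n.2 * e.2 + 40 * (|n.1| + |n.2|) < n.1 * g.1 + n.2 * g.2) :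
      f (toPlane z) < f (toPlane w) := by
    have h1 := abs_le.1 (near hz)
    have h2 := abs_le.1 (near hw)
    have h3 : (n.1 * e.1 + n.2 * e.2 + 40 * (|(n.1 : ℝ)| + |(n.2 : ℝ)|) : ℝ)
      < n.1 * g.1 + n.2 * g.2 := by exact_mod_cast h
    linarith [h1.1, h1.2, h2.1, h2.2]
  simp only [separates, Bool.and_eq_true, decide_eq_true_eq] at h
  obtain ⟨⟨⟨h1, h2⟩, h3⟩, h4⟩ := h
  have left : segment ℝ (toPlane p) (toPlane q) ⊆
      {z | f z ≤ max (f (toPlane p)) (f (toPlane q))} :=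
    (convex_halfSpace_le f.isLinear _).segment_subset (by simp) (by simp)
  have right : segment ℝ (toPlane x) (toPlane y) ⊆
      {z | max (f (toPlane p)) (f (toPlane q)) < f z} :=
    (convex_halfSpace_gt f.isLinear _).segment_subset
      (max_lt (lt hp hx h1) (lt hq hx h3)) (max_lt (lt hp hy h2) (lt hq hy h4))
  exact Set.disjoint_left.2 fun z hz hz' ↦ not_lt_of_ge (show f z ≤ _ from left hz) (right hz')

lemma disjoint_segment_of_apart {a b c d : ℤ × ℤ} {p q x y : ℝ × ℝ}
    (h : apart a b c d) (hp : IsNear p a) (hq : IsNear q b) (hx : IsNear x c)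
    (hy : IsNear y d) :
    Disjoint (segment ℝ (toPlane p) (toPlane q)) (segment ℝ (toPlane x) (toPlane y)) := by
  obtain ⟨n, -, h⟩ := List.any_eq_true.1 h
  rw [Bool.or_eq_true] at h
  rcases h with h | h
  · exact disjoint_segment_of_separates h hp hq hx hy
  · exact (disjoint_segment_of_separates h hx hy hp hq).symm

/-- Two unit segments with a common end and different other ends meet only in the common end. -/
lemma segment_inter_subset_of_dist_eq_one {F : Type*} [NormedAddCommGroup F] [NormedSpace ℝ F]
    {m p q : F} (hp : dist m p = 1) (hq : dist m q = 1) (hpq : p ≠ q) :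
    segment ℝ m p ∩ segment ℝ m q ⊆ {m} := by
  rw [segment_eq_image', segment_eq_image']
  rintro z ⟨⟨s, hs, rfl⟩, ⟨t, ht, hst⟩⟩
  have h : t • (q - m) = s • (p - m) := add_left_cancel hst
  have hts : t = s := by
    have := congrArg norm h
    rwa [norm_smul, norm_smul, ← dist_eq_norm, ← dist_eq_norm, dist_comm q, dist_comm p, hp, hq,
      mul_one, mul_one, Real.norm_of_nonneg hs.1, Real.norm_of_nonneg ht.1] at this
  subst hts
  rcases eq_or_ne t 0 with rfl | h0
  · simp
  · exact absurd (sub_left_injective (smul_right_injective F h0 h)).symm hpq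

/-- A straight-line drawing by unit segments, those without a common end being disjoint, of a
simple `d`-regular graph gives a `d`-regular matchstick graph. -/
lemma exists_matchstickGraph {n m d : ℕ} (P : Fin n → EuclideanSpace ℝ (Fin 2))
    (a b : Fin m → Fin n) (hP : Function.Injective P) (hab : ∀ k, a k ≠ b k)
    (hinj : ∀ k l, k ≠ l → s(a k, b k) ≠ s(a l, b l))
    (hunit : ∀ k, dist (P (a k)) (P (b k)) = 1)
    (hdisj : ∀ k l, k ≠ l → a k ≠ a l → a k ≠ b l → b k ≠ a l → b k ≠ b l →
      Disjoint (segment ℝ (P (a k)) (P (b k))) (segment ℝ (P (a l)) (P (b l))))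
    (hdeg : ∀ i, (Finset.univ.filter fun k ↦ i = a k ∨ i = b k).card = d) :
    ∃ G : MatchstickGraph, (∀ v ∈ G.V, G.degree v = d) ∧ G.V.card = n := by
  have hedge : Function.Injective fun k ↦ s(P (a k), P (b k)) := by
    intro k l h
    by_contra hkl
    exact hinj k l hkl (Sym2.map.injective hP h)
  have hcross (k l : Fin m) (hkl : k ≠ l) :
      segment ℝ (P (a k)) (P (b k)) ∩ segment ℝ (P (a l)) (P (b l)) ⊆
        ({P (a k), P (b k)} : Set _) ∩ {P (a l), P (b l)} := by
    have hne := hinj k l hkl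
    have hk := hunit k
    have hl := hunit l
    by_cases h1 : a k = a l
    · have h2 : P (b k) ≠ P (b l) := fun h ↦ hne (by rw [h1, hP h])
      rw [h1] at hk ⊢
      exact (segment_inter_subset_of_dist_eq_one hk hl h2).trans (by simp)
    by_cases h2 : a k = b l
    · have h3 : P (b k) ≠ P (a l) := fun h ↦ hne (by rw [h2, hP h, Sym2.eq_swap])
      rw [h2] at hk ⊢
      rw [dist_comm] at hl
      rw [segment_symm ℝ (P (a l))]
      exact (segment_inter_subset_of_dist_eq_one hk hl h3).trans (by simp)
    by_cases h3 : b k = a l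
    · have h4 : P (a k) ≠ P (b l) := fun h ↦ hne (by rw [h3, hP h, Sym2.eq_swap])
      rw [h3] at hk ⊢
      rw [dist_comm] at hk
      rw [segment_symm ℝ (P (a k))]
      exact (segment_inter_subset_of_dist_eq_one hk hl h4).trans (by simp)
    by_cases h4 : b k = b l
    · have h5 : P (a k) ≠ P (a l) := fun h ↦ hne (by rw [h4, hP h])
      rw [h4] at hk ⊢
      rw [dist_comm] at hk hl
      rw [segment_symm ℝ (P (a k)), segment_symm ℝ (P (a l))]
      exact (segment_inter_subset_of_dist_eq_one hk hl h5).trans (by simp)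
    rw [(hdisj k l hkl h1 h2 h3 h4).inter_eq]
    exact Set.empty_subset _
  let G : MatchstickGraph :=
    { V := Finset.univ.image P
      E := Finset.univ.image fun k ↦ s(P (a k), P (b k))
      edge_mem := by
        intro e he u v huv
        obtain ⟨k, -, rfl⟩ := Finset.mem_image.1 he
        rcases Sym2.eq_iff.1 huv with ⟨rfl, rfl⟩ | ⟨rfl, rfl⟩ <;> simp
      edge_ne := by
        intro e he
        obtain ⟨k, -, rfl⟩ := Finset.mem_image.1 he
        exact fun h ↦ hab k (hP (Sym2.mk_isDiag_iff.1 h))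
      edge_unit := by
        intro e he u v huv
        obtain ⟨k, -, rfl⟩ := Finset.mem_image.1 he
        rcases Sym2.eq_iff.1 huv with ⟨rfl, rfl⟩ | ⟨rfl, rfl⟩
        · exact hunit k
        · rw [dist_comm]; exact hunit k
      noncross := by
        intro e he f hf hef u v x y hu hx
        obtain ⟨k, -, rfl⟩ := Finset.mem_image.1 he
        obtain ⟨l, -, rfl⟩ := Finset.mem_image.1 hf
        have := hcross k l (fun h ↦ hef (by rw [h]))
        rcases Sym2.eq_iff.1 hu with ⟨rfl, rfl⟩ | ⟨rfl, rfl⟩ <;>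
        rcases Sym2.eq_iff.1 hx with ⟨rfl, rfl⟩ | ⟨rfl, rfl⟩ <;>
        simpa only [segment_symm ℝ (P (b _)), Set.pair_comm (P (b _))] using this }
  refine ⟨G, ?_, ?_⟩
  · intro v hv
    obtain ⟨i, -, rfl⟩ := Finset.mem_image.1 hv
    rw [← hdeg i, MatchstickGraph.degree, Finset.filter_image,
      Finset.card_image_of_injective _ hedge]
    congr 1
    ext k
    simp [hP.eq_iff]
  · rw [Finset.card_image_of_injective _ hP, Finset.card_univ, Fintype.card_fin]

/-- The approximate positions of distinct vertices are too far apart for a coincidence. -/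
lemma approx_far : ∀ i j : Fin 68, |(place approx i).1 - (place approx j).1| ≤ 40 →
    |(place approx i).2 - (place approx j).2| ≤ 40 → i = j := by decide +kernel

/-- The approximate positions of edges without a common end are separated. -/
lemma approx_apart : ∀ k l, k ≠ l → source k ≠ source l → source k ≠ target l →
    target k ≠ source l → target k ≠ target l →
      apart (place approx (source k)) (place approx (target k))
        (place approx (source l)) (place approx (target l)) := by decide +kernel

lemma edge_ne_edge : ∀ k l, k ≠ l → s(source k, target k) ≠ s(source l, target l) := by
  decide +kernel

lemma card_incident : ∀ i, (Finset.univ.filter fun k ↦ i = source k ∨ i = target k).card = 4 := by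
  decide +kernel

/-- There exists a 4-regular matchstick graph with exactly 68 vertices. -/
theorem exists_fourRegular_matchstick_68 :
    ∃ G : MatchstickGraph, G.IsFourRegular ∧ G.V.card = 68 := by
  obtain ⟨p, haxes, hunit, hnear⟩ := exists_base_points
  have hplace (i : Fin 68) : IsNear (place p i) (place approx i) := (hnear _).squareSymm _
  refine exists_matchstickGraph (fun i ↦ toPlane (place p i)) source target ?_ ?_ ?_ ?_ ?_ ?_
  · refine toPlane_injective.comp fun i j hij ↦ ?_
    have hi := hplace i
    have hj := hplace j
    rw [hij] at hi
    have close {x : ℝ} {m n : ℤ} (hm : |1000 * x - m| ≤ 20) (hn : |1000 * x - n| ≤ 20) :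
        |m - n| ≤ 40 := by
      have : |(m - n : ℝ)| ≤ 40 := by
        rw [abs_le] at *
        constructor <;> linarith [hm.1, hm.2, hn.1, hn.2]
      exact_mod_cast this
    exact approx_far i j (close hi.1 hj.1) (close hi.2 hj.2)
  · decide +kernel
  · exact edge_ne_edge
  · intro k
    rw [dist_toPlane, source, target, place_index haxes (Nat.mod_lt _ (by norm_num)),
      place_index haxes (Nat.mod_lt _ (by norm_num)), sqDist_squareSymm, hunit, Real.sqrt_one]
  · intro k l hkl h1 h2 h3 h4
    exact disjoint_segment_of_apart (approx_apart k l hkl h1 h2 h3 h4)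
      (hplace _) (hplace _) (hplace _) (hplace _)
  · exact card_incident
end

section
/- There exists a 4-regular matchstick graph with exactly 116 vertices. -/
open scoped Classical

namespace Matchstick

/-! ### Intersections of plane segments -/

/-- The grid point `w` describes the complex number `z` up to `1/200` in each coordinate:
grid coordinates are thousandths, shifted by `10`. -/
def Near (z : ℂ) (w : ℕ × ℕ) : Prop :=
  |1000 * z.re + 10000 - w.1| ≤ 5 ∧ |1000 * z.im + 10000 - w.2| ≤ 5

theorem disjoint_segment_of_functional {a b c d : ℂ} (p q : ℝ)
    (hac : p * a.re + q * a.im < p * c.re + q * c.im)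
    (had : p * a.re + q * a.im < p * d.re + q * d.im)
    (hbc : p * b.re + q * b.im < p * c.re + q * c.im)
    (hbd : p * b.re + q * b.im < p * d.re + q * d.im) :
    Disjoint (segment ℝ a b) (segment ℝ c d) := by
  rw [Set.disjoint_left]
  rintro z ⟨s, t, hs, ht, hst, rfl⟩ ⟨s', t', hs', ht', hst', h⟩
  have hre := congrArg Complex.re h
  have him := congrArg Complex.im h
  simp only [Complex.add_re, Complex.smul_re, Complex.add_im, Complex.smul_im,
    smul_eq_mul] at hre him
  have hφ : s' * (p * c.re + q * c.im) + t' * (p * d.re + q * d.im)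
      = s * (p * a.re + q * a.im) + t * (p * b.re + q * b.im) := by
    linear_combination p * hre + q * him
  generalize p * a.re + q * a.im = A at *
  generalize p * b.re + q * b.im = B at *
  generalize p * c.re + q * c.im = C at *
  generalize p * d.re + q * d.im = D at *
  have h1 : s * A + t * B ≤ max A B := by
    have := mul_le_mul_of_nonneg_left (le_max_left A B) hs
    have := mul_le_mul_of_nonneg_left (le_max_right A B) ht
    have : (s + t) * max A B = max A B := by rw [hst, one_mul]
    linarith
  have h2 : min C D ≤ s' * C + t' * D := by
    have := mul_le_mul_of_nonneg_left (min_le_left C D) hs'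
    have := mul_le_mul_of_nonneg_left (min_le_right C D) ht'
    have : (s' + t') * min C D = min C D := by rw [hst', one_mul]
    linarith
  have h3 : max A B < min C D := by
    rw [max_lt_iff, lt_min_iff, lt_min_iff]
    exact ⟨⟨hac, had⟩, hbc, hbd⟩
  linarith

theorem segment_inter_of_cross_or_dot {s u v : ℂ} (hu : u ≠ s)
    (h : (u.re - s.re) * (v.im - s.im) - (u.im - s.im) * (v.re - s.re) ≠ 0 ∨
      (u.re - s.re) * (v.re - s.re) + (u.im - s.im) * (v.im - s.im) < 0) :
    segment ℝ s u ∩ segment ℝ s v ⊆ {s} := by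
  rintro z ⟨hzu, hzv⟩
  rw [segment_eq_image'] at hzu hzv
  obtain ⟨t, ⟨ht, -⟩, rfl⟩ := hzu
  obtain ⟨t', ⟨ht', -⟩, h'⟩ := hzv
  have hre := congrArg Complex.re h'
  have him := congrArg Complex.im h'
  simp only [Complex.add_re, Complex.smul_re, Complex.add_im, Complex.smul_im,
    smul_eq_mul, Complex.sub_re, Complex.sub_im, add_right_inj] at hre him
  suffices t = 0 by simp [this]
  rcases h with h | h
  · refine (mul_eq_zero.1 ?_).resolve_right h
    linear_combination (v.re - s.re) * him - (v.im - s.im) * hre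
  · by_contra hne
    have htpos : 0 < t := lt_of_le_of_ne ht (Ne.symm hne)
    have hpos : 0 < (u.re - s.re) ^ 2 + (u.im - s.im) ^ 2 := by
      by_contra hle
      have h1 : u.re - s.re = 0 := by nlinarith [sq_nonneg (u.re - s.re), sq_nonneg (u.im - s.im)]
      have h2 : u.im - s.im = 0 := by nlinarith [sq_nonneg (u.re - s.re), sq_nonneg (u.im - s.im)]
      exact hu (Complex.ext (by linarith) (by linarith))
    have : t * ((u.re - s.re) ^ 2 + (u.im - s.im) ^ 2)
        = t' * ((u.re - s.re) * (v.re - s.re) + (u.im - s.im) * (v.im - s.im)) := by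
      linear_combination -(u.re - s.re) * hre - (u.im - s.im) * him
    nlinarith [mul_pos htpos hpos]

/-! ### Certified checks on grid points -/

/-- Two segments with these grid end points are separated by a vertical line. -/
def gap (a b c d : ℕ) : Bool :=
  (a + 10).blt c && (a + 10).blt d && (b + 10).blt c && (b + 10).blt d

/-- The linear functional `(p, q)` is larger at `c` than at `a`, with some margin. -/
def above (p q : ℤ) (a c : ℕ × ℕ) : Bool :=
  decide (10 * (|p| + |q|) < p * ((c.1 : ℤ) - a.1) + q * ((c.2 : ℤ) - a.2))

/-- The linear functional `(p, q)` separates the segments `ab` and `cd`. -/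
def separates (p q : ℤ) (a b c d : ℕ × ℕ) : Bool :=
  above p q a c && above p q a d && above p q b c && above p q b d

/-- The direction of `uv` or the orthogonal direction separates the segments `ab` and `cd`. -/
def separatesAlong (u v a b c d : ℕ × ℕ) : Bool :=
  let x := (v.1 : ℤ) - u.1
  let y := (v.2 : ℤ) - u.2
  separates x y a b c d || separates (-x) (-y) a b c d ||
    separates y (-x) a b c d || separates (-y) x a b c d

/-- A sufficient criterion for the segments `ab` and `cd` to be disjoint. -/
def apart (a b c d : ℕ × ℕ) : Bool :=
  gap a.1 b.1 c.1 d.1 || gap c.1 d.1 a.1 b.1 || gap a.2 b.2 c.2 d.2 || gap c.2 d.2 a.2 b.2 ||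
    separatesAlong a b a b c d || separatesAlong c d a b c d

/-- A sufficient criterion for the unit segments `su` and `sv` to meet in `s` only. -/
def fan (s u v : ℕ × ℕ) : Bool :=
  let a := (u.1 : ℤ) - s.1
  let b := (u.2 : ℤ) - s.2
  let c := (v.1 : ℤ) - s.1
  let d := (v.2 : ℤ) - s.2
  decide (60000 < |a * d - b * c|) || decide (a * c + b * d < -60000)

section soundness

variable {za zb zc zd : ℂ} {a b c d : ℕ × ℕ}

theorem disjoint_of_gap_re (ha : Near za a) (hb : Near zb b) (hc : Near zc c) (hd : Near zd d)
    (h : gap a.1 b.1 c.1 d.1) : Disjoint (segment ℝ za zb) (segment ℝ zc zd) := by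
  simp only [gap, Bool.and_eq_true, Nat.blt_eq] at h
  obtain ⟨⟨⟨h1, h2⟩, h3⟩, h4⟩ := h
  rify at h1 h2 h3 h4
  have := abs_le.1 ha.1; have := abs_le.1 hb.1; have := abs_le.1 hc.1; have := abs_le.1 hd.1
  apply disjoint_segment_of_functional 1 0 <;> linarith

theorem disjoint_of_gap_im (ha : Near za a) (hb : Near zb b) (hc : Near zc c) (hd : Near zd d)
    (h : gap a.2 b.2 c.2 d.2) : Disjoint (segment ℝ za zb) (segment ℝ zc zd) := by
  simp only [gap, Bool.and_eq_true, Nat.blt_eq] at h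
  obtain ⟨⟨⟨h1, h2⟩, h3⟩, h4⟩ := h
  rify at h1 h2 h3 h4
  have := abs_le.1 ha.2; have := abs_le.1 hb.2; have := abs_le.1 hc.2; have := abs_le.1 hd.2
  apply disjoint_segment_of_functional 0 1 <;> linarith

theorem lt_of_above {p q : ℤ} (ha : Near za a) (hc : Near zc c) (h : above p q a c) :
    p * za.re + q * za.im < p * zc.re + q * zc.im := by
  simp only [above, decide_eq_true_eq] at h
  rify at h
  have bound : ∀ (r : ℝ) {x x' y y' : ℝ}, |1000 * x + 10000 - x'| ≤ 5 →
      |1000 * y + 10000 - y'| ≤ 5 → r * (y' - x') - 10 * |r| ≤ 1000 * (r * y - r * x) := by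
    intro r x x' y y' h1 h2
    have h3 : |(y' - x') - 1000 * (y - x)| ≤ 10 := by
      rw [abs_le] at *; constructor <;> linarith [h1.1, h1.2, h2.1, h2.2]
    have h4 : r * ((y' - x') - 1000 * (y - x)) ≤ |r| * 10 :=
      (le_abs_self _).trans (abs_mul r _ ▸ mul_le_mul_of_nonneg_left h3 (abs_nonneg r))
    linarith
  have := bound p ha.1 hc.1
  have := bound q ha.2 hc.2
  linarith

theorem disjoint_of_separates {p q : ℤ} (ha : Near za a) (hb : Near zb b) (hc : Near zc c)
    (hd : Near zd d) (h : separates p q a b c d) :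
    Disjoint (segment ℝ za zb) (segment ℝ zc zd) := by
  simp only [separates, Bool.and_eq_true] at h
  obtain ⟨⟨⟨h1, h2⟩, h3⟩, h4⟩ := h
  exact disjoint_segment_of_functional p q (lt_of_above ha hc h1) (lt_of_above ha hd h2)
    (lt_of_above hb hc h3) (lt_of_above hb hd h4)

theorem disjoint_of_separatesAlong {u v : ℕ × ℕ} (ha : Near za a) (hb : Near zb b)
    (hc : Near zc c) (hd : Near zd d) (h : separatesAlong u v a b c d) :
    Disjoint (segment ℝ za zb) (segment ℝ zc zd) := by
  simp only [separatesAlong, Bool.or_eq_true] at h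
  rcases h with ((h | h) | h) | h <;> exact disjoint_of_separates ha hb hc hd h

theorem disjoint_of_apart (ha : Near za a) (hb : Near zb b) (hc : Near zc c) (hd : Near zd d)
    (h : apart a b c d) : Disjoint (segment ℝ za zb) (segment ℝ zc zd) := by
  simp only [apart, Bool.or_eq_true] at h
  rcases h with ((((h | h) | h) | h) | h) | h
  · exact disjoint_of_gap_re ha hb hc hd h
  · exact (disjoint_of_gap_re hc hd ha hb h).symm
  · exact disjoint_of_gap_im ha hb hc hd h
  · exact (disjoint_of_gap_im hc hd ha hb h).symm
  · exact disjoint_of_separatesAlong ha hb hc hd h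
  · exact disjoint_of_separatesAlong ha hb hc hd h

/-- Error bound for products of differences of grid coordinates. -/
theorem abs_mul_sub_mul_le {x y m n : ℝ} (hx : |x| ≤ 1) (hy : |y| ≤ 1)
    (hm : |1000 * x - m| ≤ 10) (hn : |1000 * y - n| ≤ 10) :
    |1000000 * (x * y) - m * n| ≤ 20100 := by
  have key : 1000000 * (x * y) - m * n = 1000 * x * (1000 * y - n) + 1000 * y * (1000 * x - m)
      - (1000 * x - m) * (1000 * y - n) := by ring
  have h1 := mul_le_mul hx hn (abs_nonneg _) zero_le_one
  have h2 := mul_le_mul hy hm (abs_nonneg _) zero_le_one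
  have h3 := mul_le_mul hm hn (abs_nonneg _) (by norm_num)
  rw [← abs_mul, abs_le] at h1 h2 h3
  rw [key, abs_le]
  constructor <;> linarith [h1.1, h1.2, h2.1, h2.2, h3.1, h3.2]

theorem segment_inter_of_fan (ha : Near za a) (hb : Near zb b) (hc : Near zc c)
    (hab : ‖za - zb‖ = 1) (hac : ‖za - zc‖ = 1) (h : fan a b c) :
    segment ℝ za zb ∩ segment ℝ za zc ⊆ {za} := by
  have near_sub : ∀ {x x' y y' : ℝ}, |1000 * x + 10000 - x'| ≤ 5 →
      |1000 * y + 10000 - y'| ≤ 5 → |1000 * (y - x) - (y' - x')| ≤ 10 := by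
    intro x x' y y' h1 h2
    rw [abs_le] at *; constructor <;> linarith [h1.1, h1.2, h2.1, h2.2]
  rw [norm_sub_rev] at hab hac
  have ure : |zb.re - za.re| ≤ 1 := hab ▸ Complex.abs_re_le_norm (zb - za)
  have uim : |zb.im - za.im| ≤ 1 := hab ▸ Complex.abs_im_le_norm (zb - za)
  have vre : |zc.re - za.re| ≤ 1 := hac ▸ Complex.abs_re_le_norm (zc - za)
  have vim : |zc.im - za.im| ≤ 1 := hac ▸ Complex.abs_im_le_norm (zc - za)
  have e1 := abs_le.1 (abs_mul_sub_mul_le ure vim (near_sub ha.1 hb.1) (near_sub ha.2 hc.2))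
  have e2 := abs_le.1 (abs_mul_sub_mul_le uim vre (near_sub ha.2 hb.2) (near_sub ha.1 hc.1))
  have e3 := abs_le.1 (abs_mul_sub_mul_le ure vre (near_sub ha.1 hb.1) (near_sub ha.1 hc.1))
  have e4 := abs_le.1 (abs_mul_sub_mul_le uim vim (near_sub ha.2 hb.2) (near_sub ha.2 hc.2))
  apply segment_inter_of_cross_or_dot
  · rintro rfl; simp at hab
  simp only [fan, Bool.or_eq_true, decide_eq_true_eq] at h
  rcases h with h | h
  · left
    rify at h
    intro h0
    rw [lt_abs] at h
    rcases h with h | h <;> linarith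
  · right
    rify at h
    linarith

end soundness

/-! ### Stick diagrams -/

/-- An edge of a drawing: the labels of its end points, and grid points describing them. -/
structure Stick where
  a : ℕ
  b : ℕ
  p : ℕ × ℕ
  q : ℕ × ℕ

/-- A sufficient criterion for two sticks not to cross. -/
def compatible (e f : Stick) : Bool :=
  bif e.a.beq f.a then fan e.p e.q f.q
  else bif e.a.beq f.b then fan e.p e.q f.p
  else bif e.b.beq f.a then fan e.q e.p f.q
  else bif e.b.beq f.b then fan e.q e.p f.p
  else apart e.p e.q f.p f.q

/-- All pairs of sticks in the list satisfy the criterion. -/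
def allCompatible : List Stick → Bool
  | [] => true
  | e :: l => l.all (compatible e) && allCompatible l

theorem pairwise_of_allCompatible : ∀ {l : List Stick}, allCompatible l →
    l.Pairwise (fun e f => compatible e f)
  | [], _ => List.Pairwise.nil
  | e :: l, h => by
    rw [allCompatible, Bool.and_eq_true, List.all_eq_true] at h
    exact List.pairwise_cons.2 ⟨h.1, pairwise_of_allCompatible h.2⟩

/-- The map `pos` realises the stick as a unit segment close to the prescribed grid points. -/
structure Realises (pos : ℕ → ℂ) (e : Stick) : Prop where
  near_fst : Near (pos e.a) e.p
  near_snd : Near (pos e.b) e.q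
  unit : ‖pos e.a - pos e.b‖ = 1

theorem segment_inter_of_compatible {pos : ℕ → ℂ} {e f : Stick} (he : Realises pos e)
    (hf : Realises pos f) (h : compatible e f) :
    segment ℝ (pos e.a) (pos e.b) ∩ segment ℝ (pos f.a) (pos f.b) ⊆
      ({pos e.a, pos e.b} ∩ {pos f.a, pos f.b} : Set ℂ) := by
  have he' := norm_sub_rev (pos e.a) (pos e.b) ▸ he.unit
  have hf' := norm_sub_rev (pos f.a) (pos f.b) ▸ hf.unit
  simp only [compatible, cond_eq_ite, Nat.beq_eq] at h
  split_ifs at h with h1 h2 h3 h4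
  · have := segment_inter_of_fan he.near_fst he.near_snd hf.near_snd he.unit (h1 ▸ hf.unit) h
    rw [← h1]
    exact this.trans (by simp)
  · have := segment_inter_of_fan he.near_fst he.near_snd hf.near_fst he.unit (h2 ▸ hf') h
    rw [← h2, segment_symm ℝ (pos f.a)]
    exact this.trans (by simp)
  · have := segment_inter_of_fan he.near_snd he.near_fst hf.near_snd he' (h3 ▸ hf.unit) h
    rw [← h3, segment_symm ℝ (pos e.a)]
    exact this.trans (by simp)
  · have := segment_inter_of_fan he.near_snd he.near_fst hf.near_fst he' (h4 ▸ hf') h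
    rw [← h4, segment_symm ℝ (pos e.a), segment_symm ℝ (pos f.a)]
    exact this.trans (by simp)
  · have := disjoint_of_apart he.near_fst he.near_snd hf.near_fst hf.near_snd h
    rw [this.inter_eq]
    exact Set.empty_subset _

/-! ### From stick diagrams to matchstick graphs -/

/-- The isometric identification of the complex plane with the Euclidean plane. -/
noncomputable def toPlane : ℂ ≃ₗᵢ[ℝ] EuclideanSpace ℝ (Fin 2) :=
  Complex.orthonormalBasisOneI.repr

theorem toPlane_segment (a b : ℂ) :
    segment ℝ (toPlane a) (toPlane b) = toPlane '' segment ℝ a b :=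
  (image_segment ℝ toPlane.toLinearEquiv.toLinearMap.toAffineMap a b).symm

/-- The edge of the Euclidean plane drawn by a stick. -/
noncomputable def Stick.edge (pos : ℕ → ℂ) (e : Stick) : Sym2 (EuclideanSpace ℝ (Fin 2)) :=
  s(toPlane (pos e.a), toPlane (pos e.b))

theorem exists_fourRegular_of_sticks {pos : ℕ → ℂ} {vs : List ℕ} {es : List Stick}
    (hreal : ∀ e ∈ es, Realises pos e) (hcomp : allCompatible es)
    (hinj : ∀ i ∈ vs, ∀ j ∈ vs, pos i = pos j → i = j) (hvs : vs.Nodup)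
    (hmem : ∀ e ∈ es, e.a ∈ vs ∧ e.b ∈ vs) (hlt : ∀ e ∈ es, e.a < e.b)
    (hes : (es.map fun e => (e.a, e.b)).Nodup)
    (hdeg : ∀ i ∈ vs, es.countP (fun e => e.a == i || e.b == i) = 4) :
    ∃ G : MatchstickGraph, G.IsFourRegular ∧ G.V.card = vs.length := by
  have hplane : ∀ i ∈ vs, ∀ j ∈ vs, toPlane (pos i) = toPlane (pos j) ↔ i = j := fun i hi j hj =>
    ⟨fun h => hinj i hi j hj (toPlane.injective h), fun h => by rw [h]⟩
  have hedge : ∀ e ∈ es, ∀ f ∈ es, e.edge pos = f.edge pos → (e.a, e.b) = (f.a, f.b) := by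
    intro e he f hf h
    rw [Stick.edge, Stick.edge, Sym2.eq_iff, hplane _ (hmem e he).1 _ (hmem f hf).1,
      hplane _ (hmem e he).2 _ (hmem f hf).2, hplane _ (hmem e he).1 _ (hmem f hf).2,
      hplane _ (hmem e he).2 _ (hmem f hf).1] at h
    have := hlt e he
    have := hlt f hf
    rw [Prod.mk.injEq]
    omega
  have hnodup : (es.map (Stick.edge pos)).Nodup := by
    rw [List.Nodup, List.pairwise_map] at hes ⊢
    exact hes.imp_of_mem fun he hf hne h => hne (hedge _ he _ hf h)
  have hcross : ∀ e ∈ es, ∀ f ∈ es, e ≠ f →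
      segment ℝ (pos e.a) (pos e.b) ∩ segment ℝ (pos f.a) (pos f.b) ⊆
        ({pos e.a, pos e.b} ∩ {pos f.a, pos f.b} : Set ℂ) := by
    intro e he f hf hne
    let R : Stick → Stick → Prop := fun e f =>
      segment ℝ (pos e.a) (pos e.b) ∩ segment ℝ (pos f.a) (pos f.b) ⊆
        ({pos e.a, pos e.b} ∩ {pos f.a, pos f.b} : Set ℂ)
    have : Std.Symm R := ⟨fun e f h => by
      simp only [R] at h ⊢
      rwa [Set.inter_comm, Set.inter_comm {pos f.a, pos f.b}]⟩
    have hR : es.Pairwise R := (pairwise_of_allCompatible hcomp).imp_of_mem fun he hf h =>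
      segment_inter_of_compatible (hreal _ he) (hreal _ hf) h
    exact hR.forall he hf hne
  refine ⟨⟨(vs.map fun i => toPlane (pos i)).toFinset, (es.map (Stick.edge pos)).toFinset,
    ?_, ?_, ?_, ?_⟩, ?_, ?_⟩
  · simp only [List.mem_toFinset, List.mem_map]
    rintro _ ⟨e, he, rfl⟩ u v h
    rw [Stick.edge, Sym2.eq_iff] at h
    obtain ⟨ha, hb⟩ := hmem e he
    rcases h with ⟨rfl, rfl⟩ | ⟨rfl, rfl⟩
    · exact ⟨⟨_, ha, rfl⟩, _, hb, rfl⟩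
    · exact ⟨⟨_, hb, rfl⟩, _, ha, rfl⟩
  · simp only [List.mem_toFinset, List.mem_map]
    rintro _ ⟨e, he, rfl⟩
    rw [Stick.edge, Sym2.mk_isDiag_iff, hplane _ (hmem e he).1 _ (hmem e he).2]
    exact (hlt e he).ne
  · simp only [List.mem_toFinset, List.mem_map]
    rintro _ ⟨e, he, rfl⟩ u v h
    rw [Stick.edge, Sym2.eq_iff] at h
    have hunit : dist (toPlane (pos e.a)) (toPlane (pos e.b)) = 1 := by
      rw [toPlane.dist_map, dist_eq_norm, (hreal e he).unit]
    rcases h with ⟨rfl, rfl⟩ | ⟨rfl, rfl⟩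
    · exact hunit
    · rw [dist_comm, hunit]
  · simp only [List.mem_toFinset, List.mem_map]
    rintro _ ⟨e, he, rfl⟩ _ ⟨f, hf, rfl⟩ hne u v x y hu hx
    have key : segment ℝ (toPlane (pos e.a)) (toPlane (pos e.b)) ∩
        segment ℝ (toPlane (pos f.a)) (toPlane (pos f.b)) ⊆
        ({toPlane (pos e.a), toPlane (pos e.b)} ∩ {toPlane (pos f.a), toPlane (pos f.b)} :
          Set (EuclideanSpace ℝ (Fin 2))) := by
      rw [toPlane_segment, toPlane_segment, ← Set.image_inter toPlane.injective,
        ← Set.image_pair toPlane, ← Set.image_pair toPlane, ← Set.image_inter toPlane.injective]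
      exact Set.image_mono (hcross e he f hf fun h => hne (by rw [h]))
    rw [Stick.edge, Sym2.eq_iff] at hu hx
    rcases hu with ⟨rfl, rfl⟩ | ⟨rfl, rfl⟩ <;> rcases hx with ⟨rfl, rfl⟩ | ⟨rfl, rfl⟩
    · exact key
    · rwa [segment_symm ℝ (toPlane (pos f.b)), Set.pair_comm (toPlane (pos f.b))]
    · rwa [segment_symm ℝ (toPlane (pos e.b)), Set.pair_comm (toPlane (pos e.b))]
    · rwa [segment_symm ℝ (toPlane (pos e.b)), Set.pair_comm (toPlane (pos e.b)),
        segment_symm ℝ (toPlane (pos f.b)), Set.pair_comm (toPlane (pos f.b))]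
  · intro v hv
    simp only [List.mem_toFinset, List.mem_map] at hv
    obtain ⟨i, hi, rfl⟩ := hv
    have hfilter : (es.map (Stick.edge pos)).toFinset.filter (fun e => toPlane (pos i) ∈ e) =
        ((es.map (Stick.edge pos)).filter fun e => toPlane (pos i) ∈ e).toFinset := by
      ext; simp
    rw [MatchstickGraph.degree, hfilter, List.toFinset_card_of_nodup (hnodup.filter _),
      ← List.countP_eq_length_filter, List.countP_map, ← hdeg i hi]
    refine List.countP_congr fun e he => ?_
    simp only [Function.comp_apply, decide_eq_true_eq, Stick.edge, Sym2.mem_iff,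
      hplane _ hi _ (hmem e he).1, hplane _ hi _ (hmem e he).2, Bool.or_eq_true, beq_iff_eq]
    rw [eq_comm, eq_comm (a := i)]
  · rw [List.toFinset_card_of_nodup, List.length_map]
    exact hvs.map_on fun i hi j hj h => (hplane i hi j hj).1 h

/-! ### The diagram -/

/-- Grid points describing the `131` local vertices of the ten pieces: the core occupies the
labels below `23`, and the `k`-th kite the labels from `23 + 12 * k`. -/
def grid : List (ℕ × ℕ) := [
  (10000, 10000), (10000, 10381), (10000, 8306), (9344, 9245), (9018, 10190), (8363, 9435),
  (9000, 8306), (8500, 7440), (9500, 7440), (6703, 8319), (8431, 8438), (7602, 7879),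
  (7533, 8877), (10656, 9245), (10982, 10190), (11637, 9435), (11000, 8306), (11500, 7440),
  (10500, 7440), (13297, 8319), (11569, 8438), (12398, 7879), (12467, 8877), (10000, 10381),
  (9500, 11247), (10500, 11247), (10000, 13183), (8073, 12648), (11927, 12648), (9750, 12215),
  (9036, 12916), (8786, 11947), (10250, 12215), (10964, 12916), (11214, 11947), (9490, 15265),
  (8501, 15418), (8863, 14485), (6877, 14251), (6679, 16241), (8073, 12648), (7689, 14834),
  (6778, 15246), (7590, 15829), (7870, 14368), (7475, 13449), (8468, 13567), (10510, 15265),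
  (11499, 15418), (11137, 14485), (13123, 14251), (13321, 16241), (11927, 12648), (12311, 14834),
  (13222, 15246), (12410, 15829), (12130, 14368), (12525, 13449), (11532, 13567), (9490, 15265),
  (8619, 15757), (9481, 16265), (8068, 17680), (6679, 16241), (10000, 18196), (8344, 16719),
  (7373, 16961), (7649, 15999), (8774, 16972), (9034, 17938), (9741, 17231), (10510, 15265),
  (11381, 15757), (10519, 16265), (11932, 17680), (13321, 16241), (10000, 18196), (11656, 16719),
  (12627, 16961), (12351, 15999), (11226, 16972), (10966, 17938), (10259, 17231), (8749, 6157),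
  (7833, 5754), (7942, 6748), (5963, 6461), (6286, 4487), (6703, 8319), (6898, 6108),
  (6124, 5474), (7060, 5121), (6952, 6605), (6333, 7390), (7323, 7534), (11251, 6157),
  (12167, 5754), (12058, 6748), (14037, 6461), (13714, 4487), (13297, 8319), (13102, 6108),
  (13876, 5474), (12940, 5121), (13048, 6605), (13667, 7390), (12677, 7534), (8749, 6157),
  (8035, 5456), (8999, 5189), (8000, 3457), (6286, 4487), (10000, 3458), (8018, 4457),
  (7143, 3972), (7161, 4972), (8500, 4323), (9000, 3457), (9500, 4324), (11251, 6157),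
  (11965, 5456), (11001, 5189), (12000, 3457), (13714, 4487), (10000, 3458), (11982, 4457),
  (12857, 3972), (12839, 4972), (11500, 4323), (11000, 3457), (10500, 4324)]

/-- The sticks of the diagram, each vertex being given its least label. -/
def sticks : List Stick := [
  ⟨0, 3, (10000, 10000), (9344, 9245)⟩, ⟨0, 4, (10000, 10000), (9018, 10190)⟩,
  ⟨0, 13, (10000, 10000), (10656, 9245)⟩, ⟨0, 14, (10000, 10000), (10982, 10190)⟩,
  ⟨1, 4, (10000, 10381), (9018, 10190)⟩, ⟨1, 14, (10000, 10381), (10982, 10190)⟩,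
  ⟨1, 24, (10000, 10381), (9500, 11247)⟩, ⟨1, 25, (10000, 10381), (10500, 11247)⟩,
  ⟨2, 6, (10000, 8306), (9000, 8306)⟩, ⟨2, 8, (10000, 8306), (9500, 7440)⟩,
  ⟨2, 16, (10000, 8306), (11000, 8306)⟩, ⟨2, 18, (10000, 8306), (10500, 7440)⟩,
  ⟨3, 4, (9344, 9245), (9018, 10190)⟩, ⟨3, 5, (9344, 9245), (8363, 9435)⟩,
  ⟨3, 6, (9344, 9245), (9000, 8306)⟩, ⟨4, 5, (9018, 10190), (8363, 9435)⟩,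
  ⟨5, 10, (8363, 9435), (8431, 8438)⟩, ⟨5, 12, (8363, 9435), (7533, 8877)⟩,
  ⟨6, 7, (9000, 8306), (8500, 7440)⟩, ⟨6, 8, (9000, 8306), (9500, 7440)⟩,
  ⟨7, 8, (8500, 7440), (9500, 7440)⟩, ⟨7, 10, (8500, 7440), (8431, 8438)⟩,
  ⟨7, 11, (8500, 7440), (7602, 7879)⟩, ⟨8, 18, (9500, 7440), (10500, 7440)⟩,
  ⟨9, 11, (6703, 8319), (7602, 7879)⟩, ⟨9, 12, (6703, 8319), (7533, 8877)⟩,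
  ⟨9, 93, (6703, 8319), (6333, 7390)⟩, ⟨9, 94, (6703, 8319), (7323, 7534)⟩,
  ⟨10, 11, (8431, 8438), (7602, 7879)⟩, ⟨10, 12, (8431, 8438), (7533, 8877)⟩,
  ⟨11, 12, (7602, 7879), (7533, 8877)⟩, ⟨13, 14, (10656, 9245), (10982, 10190)⟩,
  ⟨13, 15, (10656, 9245), (11637, 9435)⟩, ⟨13, 16, (10656, 9245), (11000, 8306)⟩,
  ⟨14, 15, (10982, 10190), (11637, 9435)⟩, ⟨15, 20, (11637, 9435), (11569, 8438)⟩,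
  ⟨15, 22, (11637, 9435), (12467, 8877)⟩, ⟨16, 17, (11000, 8306), (11500, 7440)⟩,
  ⟨16, 18, (11000, 8306), (10500, 7440)⟩, ⟨17, 18, (11500, 7440), (10500, 7440)⟩,
  ⟨17, 20, (11500, 7440), (11569, 8438)⟩, ⟨17, 21, (11500, 7440), (12398, 7879)⟩,
  ⟨19, 21, (13297, 8319), (12398, 7879)⟩, ⟨19, 22, (13297, 8319), (12467, 8877)⟩,
  ⟨19, 105, (13297, 8319), (13667, 7390)⟩, ⟨19, 106, (13297, 8319), (12677, 7534)⟩,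
  ⟨20, 21, (11569, 8438), (12398, 7879)⟩, ⟨20, 22, (11569, 8438), (12467, 8877)⟩,
  ⟨21, 22, (12398, 7879), (12467, 8877)⟩, ⟨24, 25, (9500, 11247), (10500, 11247)⟩,
  ⟨24, 29, (9500, 11247), (9750, 12215)⟩, ⟨24, 31, (9500, 11247), (8786, 11947)⟩,
  ⟨25, 32, (10500, 11247), (10250, 12215)⟩, ⟨25, 34, (10500, 11247), (11214, 11947)⟩,
  ⟨26, 29, (10000, 13183), (9750, 12215)⟩, ⟨26, 30, (10000, 13183), (9036, 12916)⟩,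
  ⟨26, 32, (10000, 13183), (10250, 12215)⟩, ⟨26, 33, (10000, 13183), (10964, 12916)⟩,
  ⟨27, 30, (8073, 12648), (9036, 12916)⟩, ⟨27, 31, (8073, 12648), (8786, 11947)⟩,
  ⟨27, 45, (8073, 12648), (7475, 13449)⟩, ⟨27, 46, (8073, 12648), (8468, 13567)⟩,
  ⟨28, 33, (11927, 12648), (10964, 12916)⟩, ⟨28, 34, (11927, 12648), (11214, 11947)⟩,
  ⟨28, 57, (11927, 12648), (12525, 13449)⟩, ⟨28, 58, (11927, 12648), (11532, 13567)⟩,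
  ⟨29, 30, (9750, 12215), (9036, 12916)⟩, ⟨29, 31, (9750, 12215), (8786, 11947)⟩,
  ⟨30, 31, (9036, 12916), (8786, 11947)⟩, ⟨32, 33, (10250, 12215), (10964, 12916)⟩,
  ⟨32, 34, (10250, 12215), (11214, 11947)⟩, ⟨33, 34, (10964, 12916), (11214, 11947)⟩,
  ⟨35, 36, (9490, 15265), (8501, 15418)⟩, ⟨35, 37, (9490, 15265), (8863, 14485)⟩,
  ⟨35, 60, (9490, 15265), (8619, 15757)⟩, ⟨35, 61, (9490, 15265), (9481, 16265)⟩,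
  ⟨36, 37, (8501, 15418), (8863, 14485)⟩, ⟨36, 41, (8501, 15418), (7689, 14834)⟩,
  ⟨36, 43, (8501, 15418), (7590, 15829)⟩, ⟨37, 44, (8863, 14485), (7870, 14368)⟩,
  ⟨37, 46, (8863, 14485), (8468, 13567)⟩, ⟨38, 41, (6877, 14251), (7689, 14834)⟩,
  ⟨38, 42, (6877, 14251), (6778, 15246)⟩, ⟨38, 44, (6877, 14251), (7870, 14368)⟩,
  ⟨38, 45, (6877, 14251), (7475, 13449)⟩, ⟨39, 42, (6679, 16241), (6778, 15246)⟩,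
  ⟨39, 43, (6679, 16241), (7590, 15829)⟩, ⟨39, 66, (6679, 16241), (7373, 16961)⟩,
  ⟨39, 67, (6679, 16241), (7649, 15999)⟩, ⟨41, 42, (7689, 14834), (6778, 15246)⟩,
  ⟨41, 43, (7689, 14834), (7590, 15829)⟩, ⟨42, 43, (6778, 15246), (7590, 15829)⟩,
  ⟨44, 45, (7870, 14368), (7475, 13449)⟩, ⟨44, 46, (7870, 14368), (8468, 13567)⟩,
  ⟨45, 46, (7475, 13449), (8468, 13567)⟩, ⟨47, 48, (10510, 15265), (11499, 15418)⟩,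
  ⟨47, 49, (10510, 15265), (11137, 14485)⟩, ⟨47, 72, (10510, 15265), (11381, 15757)⟩,
  ⟨47, 73, (10510, 15265), (10519, 16265)⟩, ⟨48, 49, (11499, 15418), (11137, 14485)⟩,
  ⟨48, 53, (11499, 15418), (12311, 14834)⟩, ⟨48, 55, (11499, 15418), (12410, 15829)⟩,
  ⟨49, 56, (11137, 14485), (12130, 14368)⟩, ⟨49, 58, (11137, 14485), (11532, 13567)⟩,
  ⟨50, 53, (13123, 14251), (12311, 14834)⟩, ⟨50, 54, (13123, 14251), (13222, 15246)⟩,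
  ⟨50, 56, (13123, 14251), (12130, 14368)⟩, ⟨50, 57, (13123, 14251), (12525, 13449)⟩,
  ⟨51, 54, (13321, 16241), (13222, 15246)⟩, ⟨51, 55, (13321, 16241), (12410, 15829)⟩,
  ⟨51, 78, (13321, 16241), (12627, 16961)⟩, ⟨51, 79, (13321, 16241), (12351, 15999)⟩,
  ⟨53, 54, (12311, 14834), (13222, 15246)⟩, ⟨53, 55, (12311, 14834), (12410, 15829)⟩,
  ⟨54, 55, (13222, 15246), (12410, 15829)⟩, ⟨56, 57, (12130, 14368), (12525, 13449)⟩,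
  ⟨56, 58, (12130, 14368), (11532, 13567)⟩, ⟨57, 58, (12525, 13449), (11532, 13567)⟩,
  ⟨60, 61, (8619, 15757), (9481, 16265)⟩, ⟨60, 65, (8619, 15757), (8344, 16719)⟩,
  ⟨60, 67, (8619, 15757), (7649, 15999)⟩, ⟨61, 68, (9481, 16265), (8774, 16972)⟩,
  ⟨61, 70, (9481, 16265), (9741, 17231)⟩, ⟨62, 65, (8068, 17680), (8344, 16719)⟩,
  ⟨62, 66, (8068, 17680), (7373, 16961)⟩, ⟨62, 68, (8068, 17680), (8774, 16972)⟩,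
  ⟨62, 69, (8068, 17680), (9034, 17938)⟩, ⟨64, 69, (10000, 18196), (9034, 17938)⟩,
  ⟨64, 70, (10000, 18196), (9741, 17231)⟩, ⟨64, 81, (10000, 18196), (10966, 17938)⟩,
  ⟨64, 82, (10000, 18196), (10259, 17231)⟩, ⟨65, 66, (8344, 16719), (7373, 16961)⟩,
  ⟨65, 67, (8344, 16719), (7649, 15999)⟩, ⟨66, 67, (7373, 16961), (7649, 15999)⟩,
  ⟨68, 69, (8774, 16972), (9034, 17938)⟩, ⟨68, 70, (8774, 16972), (9741, 17231)⟩,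
  ⟨69, 70, (9034, 17938), (9741, 17231)⟩, ⟨72, 73, (11381, 15757), (10519, 16265)⟩,
  ⟨72, 77, (11381, 15757), (11656, 16719)⟩, ⟨72, 79, (11381, 15757), (12351, 15999)⟩,
  ⟨73, 80, (10519, 16265), (11226, 16972)⟩, ⟨73, 82, (10519, 16265), (10259, 17231)⟩,
  ⟨74, 77, (11932, 17680), (11656, 16719)⟩, ⟨74, 78, (11932, 17680), (12627, 16961)⟩,
  ⟨74, 80, (11932, 17680), (11226, 16972)⟩, ⟨74, 81, (11932, 17680), (10966, 17938)⟩,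
  ⟨77, 78, (11656, 16719), (12627, 16961)⟩, ⟨77, 79, (11656, 16719), (12351, 15999)⟩,
  ⟨78, 79, (12627, 16961), (12351, 15999)⟩, ⟨80, 81, (11226, 16972), (10966, 17938)⟩,
  ⟨80, 82, (11226, 16972), (10259, 17231)⟩, ⟨81, 82, (10966, 17938), (10259, 17231)⟩,
  ⟨83, 84, (8749, 6157), (7833, 5754)⟩, ⟨83, 85, (8749, 6157), (7942, 6748)⟩,
  ⟨83, 108, (8749, 6157), (8035, 5456)⟩, ⟨83, 109, (8749, 6157), (8999, 5189)⟩,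
  ⟨84, 85, (7833, 5754), (7942, 6748)⟩, ⟨84, 89, (7833, 5754), (6898, 6108)⟩,
  ⟨84, 91, (7833, 5754), (7060, 5121)⟩, ⟨85, 92, (7942, 6748), (6952, 6605)⟩,
  ⟨85, 94, (7942, 6748), (7323, 7534)⟩, ⟨86, 89, (5963, 6461), (6898, 6108)⟩,
  ⟨86, 90, (5963, 6461), (6124, 5474)⟩, ⟨86, 92, (5963, 6461), (6952, 6605)⟩,
  ⟨86, 93, (5963, 6461), (6333, 7390)⟩, ⟨87, 90, (6286, 4487), (6124, 5474)⟩,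
  ⟨87, 91, (6286, 4487), (7060, 5121)⟩, ⟨87, 114, (6286, 4487), (7143, 3972)⟩,
  ⟨87, 115, (6286, 4487), (7161, 4972)⟩, ⟨89, 90, (6898, 6108), (6124, 5474)⟩,
  ⟨89, 91, (6898, 6108), (7060, 5121)⟩, ⟨90, 91, (6124, 5474), (7060, 5121)⟩,
  ⟨92, 93, (6952, 6605), (6333, 7390)⟩, ⟨92, 94, (6952, 6605), (7323, 7534)⟩,
  ⟨93, 94, (6333, 7390), (7323, 7534)⟩, ⟨95, 96, (11251, 6157), (12167, 5754)⟩,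
  ⟨95, 97, (11251, 6157), (12058, 6748)⟩, ⟨95, 120, (11251, 6157), (11965, 5456)⟩,
  ⟨95, 121, (11251, 6157), (11001, 5189)⟩, ⟨96, 97, (12167, 5754), (12058, 6748)⟩,
  ⟨96, 101, (12167, 5754), (13102, 6108)⟩, ⟨96, 103, (12167, 5754), (12940, 5121)⟩,
  ⟨97, 104, (12058, 6748), (13048, 6605)⟩, ⟨97, 106, (12058, 6748), (12677, 7534)⟩,
  ⟨98, 101, (14037, 6461), (13102, 6108)⟩, ⟨98, 102, (14037, 6461), (13876, 5474)⟩,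
  ⟨98, 104, (14037, 6461), (13048, 6605)⟩, ⟨98, 105, (14037, 6461), (13667, 7390)⟩,
  ⟨99, 102, (13714, 4487), (13876, 5474)⟩, ⟨99, 103, (13714, 4487), (12940, 5121)⟩,
  ⟨99, 126, (13714, 4487), (12857, 3972)⟩, ⟨99, 127, (13714, 4487), (12839, 4972)⟩,
  ⟨101, 102, (13102, 6108), (13876, 5474)⟩, ⟨101, 103, (13102, 6108), (12940, 5121)⟩,
  ⟨102, 103, (13876, 5474), (12940, 5121)⟩, ⟨104, 105, (13048, 6605), (13667, 7390)⟩,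
  ⟨104, 106, (13048, 6605), (12677, 7534)⟩, ⟨105, 106, (13667, 7390), (12677, 7534)⟩,
  ⟨108, 109, (8035, 5456), (8999, 5189)⟩, ⟨108, 113, (8035, 5456), (8018, 4457)⟩,
  ⟨108, 115, (8035, 5456), (7161, 4972)⟩, ⟨109, 116, (8999, 5189), (8500, 4323)⟩,
  ⟨109, 118, (8999, 5189), (9500, 4324)⟩, ⟨110, 113, (8000, 3457), (8018, 4457)⟩,
  ⟨110, 114, (8000, 3457), (7143, 3972)⟩, ⟨110, 116, (8000, 3457), (8500, 4323)⟩,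
  ⟨110, 117, (8000, 3457), (9000, 3457)⟩, ⟨112, 117, (10000, 3458), (9000, 3457)⟩,
  ⟨112, 118, (10000, 3458), (9500, 4324)⟩, ⟨112, 129, (10000, 3458), (11000, 3457)⟩,
  ⟨112, 130, (10000, 3458), (10500, 4324)⟩, ⟨113, 114, (8018, 4457), (7143, 3972)⟩,
  ⟨113, 115, (8018, 4457), (7161, 4972)⟩, ⟨114, 115, (7143, 3972), (7161, 4972)⟩,
  ⟨116, 117, (8500, 4323), (9000, 3457)⟩, ⟨116, 118, (8500, 4323), (9500, 4324)⟩,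
  ⟨117, 118, (9000, 3457), (9500, 4324)⟩, ⟨120, 121, (11965, 5456), (11001, 5189)⟩,
  ⟨120, 125, (11965, 5456), (11982, 4457)⟩, ⟨120, 127, (11965, 5456), (12839, 4972)⟩,
  ⟨121, 128, (11001, 5189), (11500, 4323)⟩, ⟨121, 130, (11001, 5189), (10500, 4324)⟩,
  ⟨122, 125, (12000, 3457), (11982, 4457)⟩, ⟨122, 126, (12000, 3457), (12857, 3972)⟩,
  ⟨122, 128, (12000, 3457), (11500, 4323)⟩, ⟨122, 129, (12000, 3457), (11000, 3457)⟩,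
  ⟨125, 126, (11982, 4457), (12857, 3972)⟩, ⟨125, 127, (11982, 4457), (12839, 4972)⟩,
  ⟨126, 127, (12857, 3972), (12839, 4972)⟩, ⟨128, 129, (11500, 4323), (11000, 3457)⟩,
  ⟨128, 130, (11500, 4323), (10500, 4324)⟩, ⟨129, 130, (11000, 3457), (10500, 4324)⟩]

/-- The labels that denote a vertex which also has another label. -/
def glued : List (ℕ × ℕ) := [
  (23, 1), (40, 27), (52, 28), (59, 35), (63, 39), (71, 47), (75, 51), (76, 64), (88, 9),
  (100, 19), (107, 83), (111, 87), (119, 95), (123, 99), (124, 112)]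

/-- The labels of the vertices. -/
def labels : List ℕ :=
  (List.range 131).filter fun i => !(glued.map Prod.fst).contains i

theorem allCompatible_sticks : allCompatible sticks := by decide +kernel

theorem length_labels : labels.length = 116 := by decide +kernel

theorem labels_lt {i : ℕ} (hi : i ∈ labels) : i < 131 :=
  List.mem_range.1 (List.mem_of_mem_filter hi)

theorem sticks_mem_labels : ∀ e ∈ sticks, e.a ∈ labels ∧ e.b ∈ labels := by decide +kernel

theorem sticks_lt : ∀ e ∈ sticks, e.a < e.b := by decide +kernel

theorem nodup_sticks : (sticks.map fun e => (e.a, e.b)).Nodup := by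
  have h : (sticks.map fun e => 131 * e.a + e.b).IsChain (· < ·) := by decide +kernel
  refine List.Nodup.of_map (fun p : ℕ × ℕ => 131 * p.1 + p.2) ?_
  rw [List.map_map]
  exact (List.isChain_iff_pairwise.1 h).imp ne_of_lt

theorem countP_sticks :
    ∀ i ∈ labels, sticks.countP (fun e => e.a == i || e.b == i) = 4 := by decide +kernel

theorem sticks_grid : ∀ e ∈ sticks, e.p = grid.getD e.a 0 ∧ e.q = grid.getD e.b 0 := by
  decide +kernel

/-- Two grid points that do not describe a common point. -/
def distinct (p q : ℕ × ℕ) : Bool :=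
  (p.1 + 10).blt q.1 || (q.1 + 10).blt p.1 || (p.2 + 10).blt q.2 || (q.2 + 10).blt p.2

/-- All pairs of grid points in the list describe distinct points. -/
def allDistinct : List (ℕ × ℕ) → Bool
  | [] => true
  | p :: l => l.all (distinct p) && allDistinct l

theorem pairwise_of_allDistinct : ∀ {l : List (ℕ × ℕ)}, allDistinct l →
    l.Pairwise (fun p q => distinct p q)
  | [], _ => List.Pairwise.nil
  | p :: l, h => by
    rw [allDistinct, Bool.and_eq_true, List.all_eq_true] at h
    exact List.pairwise_cons.2 ⟨h.1, pairwise_of_allDistinct h.2⟩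

theorem allDistinct_grid : allDistinct (labels.map fun i => grid.getD i 0) := by decide +kernel

theorem Near.ne_of_distinct {z w : ℂ} {p q : ℕ × ℕ} (hz : Near z p) (hw : Near w q)
    (h : distinct p q) : z ≠ w := by
  rintro rfl
  simp only [distinct, Bool.or_eq_true, Nat.blt_eq] at h
  have := abs_le.1 hz.1; have := abs_le.1 hz.2; have := abs_le.1 hw.1; have := abs_le.1 hw.2
  rcases h with ((h | h) | h) | h <;> rify at h <;> linarith

theorem eq_of_pos_eq {pos : ℕ → ℂ} (hpos : ∀ i < 131, Near (pos i) (grid.getD i 0)) :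
    ∀ i ∈ labels, ∀ j ∈ labels, pos i = pos j → i = j := by
  let R : ℕ → ℕ → Prop := fun i j => pos i ≠ pos j
  have : Std.Symm R := ⟨fun _ _ h => h.symm⟩
  have hR : labels.Pairwise R :=
    (List.pairwise_map.1 (pairwise_of_allDistinct allDistinct_grid)).imp_of_mem fun hi hj h =>
      (hpos _ (labels_lt hi)).ne_of_distinct (hpos _ (labels_lt hj)) h
  intro i hi j hj h
  by_contra hne
  exact hR.forall hi hj hne h

theorem nodup_labels : labels.Nodup := List.nodup_range.filter _

/-! ### Numerical estimates -/

theorem abs_mul_sub_mul_le_of {a a₀ b b₀ ε δ η : ℝ} (ha : |a - a₀| ≤ ε) (hb : |b - b₀| ≤ δ)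
    (h : ε * |b₀| + |a₀| * δ + ε * δ ≤ η) : |a * b - a₀ * b₀| ≤ η := by
  have key : a * b - a₀ * b₀ = (a - a₀) * b₀ + a₀ * (b - b₀) + (a - a₀) * (b - b₀) := by ring
  have hε : 0 ≤ ε := (abs_nonneg _).trans ha
  calc |a * b - a₀ * b₀| ≤ |(a - a₀) * b₀| + |a₀ * (b - b₀)| + |(a - a₀) * (b - b₀)| := by
        rw [key]; exact abs_add_three _ _ _
    _ ≤ ε * |b₀| + |a₀| * δ + ε * δ := by
        rw [abs_mul, abs_mul, abs_mul]; gcongr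
    _ ≤ η := h

theorem abs_sub_le_of_sq {a a₀ ε : ℝ} (ha : 0 ≤ a) (hε : ε ≤ a₀) (h0 : 0 ≤ ε)
    (h1 : (a₀ - ε) ^ 2 ≤ a ^ 2) (h2 : a ^ 2 ≤ (a₀ + ε) ^ 2) : |a - a₀| ≤ ε := by
  have := abs_le_of_sq_le_sq' h1 ha
  have := abs_le_of_sq_le_sq' h2 (by linarith)
  rw [abs_le]
  constructor <;> linarith

theorem sqrt_three_sq : √3 ^ 2 = (3 : ℝ) := Real.sq_sqrt (by norm_num)

theorem sqrt_five_sq : √5 ^ 2 = (5 : ℝ) := Real.sq_sqrt (by norm_num)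

theorem sqrt_three_approx : |√3 - 1.7320508| ≤ (0.0000001 : ℝ) := by
  apply abs_sub_le_of_sq (Real.sqrt_nonneg _) <;> (try rw [sqrt_three_sq]) <;> norm_num

theorem sqrt_five_approx : |√5 - 2.236068| ≤ (0.0000001 : ℝ) := by
  apply abs_sub_le_of_sq (Real.sqrt_nonneg _) <;> (try rw [sqrt_five_sq]) <;> norm_num

theorem sqrt_three_mul_sqrt_five_approx : |√3 * √5 - 3.872983| ≤ (0.000001 : ℝ) := by
  apply abs_sub_le_of_sq (by positivity) <;>
    (try rw [mul_pow, sqrt_three_sq, sqrt_five_sq]) <;> norm_num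

/-! ### The kite -/

/-- The kite made of a small triangle and two triangles of side length two. -/
noncomputable def kite : ℕ → ℂ
  | 0 => ⟨0, (√3 * √5 + √3) / 2⟩
  | 1 => ⟨-1 / 2, √3 * √5 / 2⟩
  | 2 => ⟨1 / 2, √3 * √5 / 2⟩
  | 3 => 0
  | 4 => ⟨-(1 + 3 * √5) / 4, (√3 * √5 - √3) / 4⟩
  | 5 => ⟨(1 + 3 * √5) / 4, (√3 * √5 - √3) / 4⟩
  | 6 => (kite 1 + kite 3) / 2
  | 7 => (kite 3 + kite 4) / 2
  | 8 => (kite 1 + kite 4) / 2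
  | 9 => (kite 2 + kite 3) / 2
  | 10 => (kite 3 + kite 5) / 2
  | 11 => (kite 2 + kite 5) / 2
  | _ => 0

/-- The edges of a triangle `abc` of side length two, subdivided at the midpoints of `ab`, `bc`
and `ac`. -/
def triangleEdges (a b c ab bc ac : ℕ) : List (ℕ × ℕ) :=
  [(a, ab), (ab, b), (b, bc), (bc, c), (c, ac), (ac, a), (ab, bc), (bc, ac), (ac, ab)]

/-- The edges of the kite. -/
def kiteEdges : List (ℕ × ℕ) :=
  [(0, 1), (0, 2), (1, 2)] ++ triangleEdges 1 3 4 6 7 8 ++ triangleEdges 2 3 5 9 10 11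

theorem norm_sub_eq_of_sq {z w : ℂ} {r : ℝ} (hr : 0 ≤ r)
    (h : (z.re - w.re) ^ 2 + (z.im - w.im) ^ 2 = r ^ 2) : ‖z - w‖ = r := by
  rw [Complex.norm_eq_sqrt_sq_add_sq, Complex.sub_re, Complex.sub_im, h, Real.sqrt_sq hr]

theorem norm_triangleEdges {P : ℕ → ℂ} {a b c ab bc ac : ℕ} (hab : ‖P a - P b‖ = 2)
    (hbc : ‖P b - P c‖ = 2) (hac : ‖P a - P c‖ = 2) (mab : P ab = (P a + P b) / 2)
    (mbc : P bc = (P b + P c) / 2) (mac : P ac = (P a + P c) / 2) :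
    ∀ e ∈ triangleEdges a b c ab bc ac, ‖P e.1 - P e.2‖ = 1 := by
  have half : ∀ {u v w : ℂ}, ‖u‖ = 2 → v - w = u / 2 ∨ v - w = -(u / 2) → ‖v - w‖ = 1 := by
    rintro u v w hu (h | h) <;> simp [h, hu]
  simp only [triangleEdges, List.forall_mem_cons, mab, mbc, mac]
  refine ⟨half hab ?_, half hab ?_, half hbc ?_, half hbc ?_, half hac ?_, half hac ?_,
    half hac ?_, half hab ?_, half hbc ?_, by simp⟩
  all_goals first | (left; ring1) | (right; ring1)

theorem norm_kiteEdges : ∀ e ∈ kiteEdges, ‖kite e.1 - kite e.2‖ = 1 := by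
  have hr := sqrt_three_sq
  have hf := sqrt_five_sq
  simp only [kiteEdges, List.forall_mem_append]
  refine ⟨⟨?_, norm_triangleEdges ?_ ?_ ?_ (by simp only [kite]) (by simp only [kite])
      (by simp only [kite])⟩,
    norm_triangleEdges ?_ ?_ ?_ (by simp only [kite]) (by simp only [kite]) (by simp only [kite])⟩
  · simp only [List.forall_mem_cons]
    refine ⟨?_, ?_, ?_, by simp⟩ <;> apply norm_sub_eq_of_sq zero_le_one <;> simp only [kite] <;>
      ring_nf <;> simp only [hr] <;> norm_num
  all_goals
    apply norm_sub_eq_of_sq zero_le_two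
    simp only [kite, Complex.zero_re, Complex.zero_im]
    ring_nf
    simp only [hr, hf]
    ring_nf

/-- The reflection that fixes `kite 0` and `kite 4`. -/
noncomputable def reflect (z : ℂ) : ℂ :=
  kite 0 + ⟨(14 - 9 * √5) / 38, √3 * (6 + 7 * √5) / 38⟩ * starRingEnd ℂ (z - kite 0)

theorem reflect_kite_zero : reflect (kite 0) = kite 0 := by simp [reflect]

theorem reflect_kite_four : reflect (kite 4) = kite 4 := by
  have hr := sqrt_three_sq
  have hf := sqrt_five_sq
  have hf3 : √5 ^ 3 = 5 * √5 := by rw [pow_succ, hf]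
  apply Complex.ext <;> simp [reflect, kite] <;> ring_nf <;> simp only [hr, hf] <;> ring_nf

theorem norm_reflect_sub (z w : ℂ) : ‖reflect z - reflect w‖ = ‖z - w‖ := by
  have hN : ‖(⟨(14 - 9 * √5) / 38, √3 * (6 + 7 * √5) / 38⟩ : ℂ)‖ = 1 := by
    rw [← sub_zero (⟨(14 - 9 * √5) / 38, √3 * (6 + 7 * √5) / 38⟩ : ℂ)]
    apply norm_sub_eq_of_sq zero_le_one
    simp only [Complex.zero_re, Complex.zero_im]
    ring_nf
    simp only [sqrt_three_sq, sqrt_five_sq]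
    ring_nf
  rw [show reflect z - reflect w = ⟨(14 - 9 * √5) / 38, √3 * (6 + 7 * √5) / 38⟩ *
    starRingEnd ℂ (z - w) by simp only [reflect, map_sub]; ring, norm_mul, hN, one_mul,
    Complex.norm_conj]

/-! ### The core -/

/-- Reflection in the imaginary axis. -/
def mirror (z : ℂ) : ℂ := ⟨-z.re, z.im⟩

theorem norm_mirror_sub (z w : ℂ) : ‖mirror z - mirror w‖ = ‖z - w‖ :=
  norm_sub_eq_of_sq (norm_nonneg _) (by
    rw [Complex.sq_norm, Complex.normSq_apply]; simp only [mirror, Complex.sub_re, Complex.sub_im]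
    ring)

/-- The shape parameters of the core, determined by the condition `closure` that the triangles
of side length two fit in. -/
structure Core where
  x : ℝ
  y : ℝ
  c : ℝ
  x_approx : |x - 0.655727| ≤ 0.00001
  y_nonneg : 0 ≤ y
  c_nonneg : 0 ≤ c
  y_sq : y ^ 2 = 1 - x ^ 2
  c_sq : c ^ 2 = 2 * x - x ^ 2
  closure : (3 / 2 * x + √3 / 2 * y - 3 / 2) ^ 2 + (y / 2 - √3 / 2 * x - c - √3 / 2) ^ 2 = 4

theorem Core.exists_core : Nonempty Core := by
  let g : ℝ → ℝ := fun x => (3 / 2 * x + √3 / 2 * √(1 - x ^ 2) - 3 / 2) ^ 2 +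
    (√(1 - x ^ 2) / 2 - √3 / 2 * x - √(2 * x - x ^ 2) - √3 / 2) ^ 2
  have hg : Continuous g := by fun_prop
  have value : ∀ {x y c p q : ℝ}, 0 ≤ y → 0 ≤ c → |√(1 - x ^ 2) - y| ≤ 0.0000001 →
      |√(2 * x - x ^ 2) - c| ≤ 0.0000001 → |y| ≤ 1 → |x| ≤ 1 →
      p = 3 / 2 * x + 1.7320508 / 2 * y - 3 / 2 →
      q = y / 2 - 1.7320508 / 2 * x - c - 1.7320508 / 2 →
      |p| ≤ 3 → |q| ≤ 3 → |g x - (p * p + q * q)| ≤ 0.000008 := by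
    intro x y c p q hy0 hc0 hy hc hy1 hx1 rfl rfl hp1 hq1
    have hry := abs_le.1 (abs_mul_sub_mul_le_of (η := 0.0000003) sqrt_three_approx hy
      (by norm_num [abs_of_pos]; linarith))
    have hrx := abs_le.1 (abs_mul_sub_mul_le_of (b := x) (η := 0.0000001) sqrt_three_approx
      (by rw [sub_self, abs_zero] : |x - x| ≤ 0) (by norm_num; linarith))
    have hr := abs_le.1 sqrt_three_approx
    rw [abs_le] at hy hc
    have hp : |(3 / 2 * x + √3 / 2 * √(1 - x ^ 2) - 3 / 2) -
        (3 / 2 * x + 1.7320508 / 2 * y - 3 / 2)| ≤ 0.0000005 := by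
      rw [abs_le]; constructor <;> linarith
    have hq : |(√(1 - x ^ 2) / 2 - √3 / 2 * x - √(2 * x - x ^ 2) - √3 / 2) -
        (y / 2 - 1.7320508 / 2 * x - c - 1.7320508 / 2)| ≤ 0.0000005 := by
      rw [abs_le]; constructor <;> linarith
    have h1 := abs_le.1 (abs_mul_sub_mul_le_of (η := 0.000004) hp hp (by linarith))
    have h2 := abs_le.1 (abs_mul_sub_mul_le_of (η := 0.000004) hq hq (by linarith))
    simp only [g]
    rw [abs_le]
    constructor <;> linarith
  have hlo : g 0.65572 < 4 := by
    have hy : |√(1 - (0.65572 : ℝ) ^ 2) - 0.75500416| ≤ 0.0000001 := by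
      apply abs_sub_le_of_sq (Real.sqrt_nonneg _) <;> (try rw [Real.sq_sqrt]) <;> norm_num
    have hc : |√(2 * 0.65572 - (0.65572 : ℝ) ^ 2) - 0.93886702| ≤ 0.0000001 := by
      apply abs_sub_le_of_sq (Real.sqrt_nonneg _) <;> (try rw [Real.sq_sqrt]) <;> norm_num
    have h := abs_le.1 (value (by norm_num) (by norm_num) hy hc (by norm_num) (by norm_num)
      rfl rfl (by norm_num) (by norm_num))
    norm_num at h
    norm_num
    linarith
  have hhi : 4 < g 0.65573 := by
    have hy : |√(1 - (0.65573 : ℝ) ^ 2) - 0.75499547| ≤ 0.0000001 := by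
      apply abs_sub_le_of_sq (Real.sqrt_nonneg _) <;> (try rw [Real.sq_sqrt]) <;> norm_num
    have hc : |√(2 * 0.65573 - (0.65573 : ℝ) ^ 2) - 0.93887069| ≤ 0.0000001 := by
      apply abs_sub_le_of_sq (Real.sqrt_nonneg _) <;> (try rw [Real.sq_sqrt]) <;> norm_num
    have h := abs_le.1 (value (by norm_num) (by norm_num) hy hc (by norm_num) (by norm_num)
      rfl rfl (by norm_num) (by norm_num))
    norm_num at h
    norm_num
    linarith
  obtain ⟨x, ⟨hx1, hx2⟩, hx⟩ := intermediate_value_Icc (by norm_num) hg.continuousOn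
    ⟨hlo.le, hhi.le⟩
  exact ⟨{
    x := x, y := √(1 - x ^ 2), c := √(2 * x - x ^ 2)
    x_approx := by rw [abs_le]; constructor <;> linarith
    y_nonneg := Real.sqrt_nonneg _
    c_nonneg := Real.sqrt_nonneg _
    y_sq := Real.sq_sqrt (by nlinarith)
    c_sq := Real.sq_sqrt (by nlinarith)
    closure := hx }⟩

namespace Core

variable (κ : Core)

theorem y_approx : |κ.y - 0.754998| ≤ 0.00002 := by
  have h := abs_le.1 κ.x_approx
  apply abs_sub_le_of_sq κ.y_nonneg <;> (try rw [κ.y_sq]) <;> norm_num at h ⊢ <;> nlinarith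

theorem c_approx : |κ.c - 0.93887| ≤ 0.00002 := by
  have h := abs_le.1 κ.x_approx
  apply abs_sub_le_of_sq κ.c_nonneg <;> (try rw [κ.c_sq]) <;> norm_num at h ⊢ <;> nlinarith

theorem sqrt_three_mul_x_approx : |√3 * κ.x - 1.135752| ≤ 0.00002 := by
  have h := abs_le.1 (abs_mul_sub_mul_le_of (η := 0.000019) sqrt_three_approx κ.x_approx
    (by norm_num))
  rw [abs_le]; constructor <;> linarith

theorem sqrt_three_mul_y_approx : |√3 * κ.y - 1.307695| ≤ 0.00004 := by
  have h := abs_le.1 (abs_mul_sub_mul_le_of (η := 0.000036) sqrt_three_approx κ.y_approx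
    (by norm_num))
  rw [abs_le]; constructor <;> linarith

theorem sqrt_three_mul_c_approx : |√3 * κ.c - 1.626171| ≤ 0.00004 := by
  have h := abs_le.1 (abs_mul_sub_mul_le_of (η := 0.000036) sqrt_three_approx κ.c_approx
    (by norm_num))
  rw [abs_le]; constructor <;> linarith

/-- The vertices of the left half of the core. -/
noncomputable def half : ℕ → ℂ
  | 0 => 0
  | 1 => ⟨0, √3 * κ.x - κ.y⟩
  | 2 => ⟨0, -κ.y - κ.c⟩
  | 3 => ⟨-κ.x, -κ.y⟩
  | 4 => ⟨-(κ.x + √3 * κ.y) / 2, (√3 * κ.x - κ.y) / 2⟩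
  | 5 => ⟨-(3 * κ.x + √3 * κ.y) / 2, (√3 * κ.x - 3 * κ.y) / 2⟩
  | 6 => ⟨-1, -κ.y - κ.c⟩
  | 7 => ⟨-3 / 2, -κ.y - κ.c - √3 / 2⟩
  | 8 => ⟨-1 / 2, -κ.y - κ.c - √3 / 2⟩
  | 9 => half 5 + (half 7 - half 5) * ⟨1 / 2, -√3 / 2⟩
  | 10 => (half 5 + half 7) / 2
  | 11 => (half 7 + half 9) / 2
  | 12 => (half 5 + half 9) / 2
  | _ => 0

/-- The edges of the left half of the core. -/
def _root_.Matchstick.halfEdges : List (ℕ × ℕ) :=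
  [(0, 3), (0, 4), (3, 4), (3, 5), (4, 5), (1, 4), (3, 6), (6, 2), (6, 7), (7, 8), (6, 8), (8, 2)]
    ++ triangleEdges 5 7 9 10 11 12

theorem norm_halfEdges : ∀ e ∈ halfEdges, ‖κ.half e.1 - κ.half e.2‖ = 1 := by
  have hr := sqrt_three_sq
  have hy := κ.y_sq
  have hc := κ.c_sq
  have hcl := κ.closure
  simp only [halfEdges, List.forall_mem_append]
  refine ⟨?_, norm_triangleEdges ?_ ?_ ?_ (by simp only [half]) (by simp only [half])
    (by simp only [half])⟩
  · simp only [List.forall_mem_cons]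
    refine ⟨?_, ?_, ?_, ?_, ?_, ?_, ?_, ?_, ?_, ?_, ?_, ?_, by simp⟩ <;>
      apply norm_sub_eq_of_sq zero_le_one <;>
      simp only [half, Complex.zero_re, Complex.zero_im] <;> ring_nf <;>
      simp only [hr, hy, hc] <;> ring_nf
  all_goals
    apply norm_sub_eq_of_sq zero_le_two
    simp only [half, Complex.add_re, Complex.add_im, Complex.mul_re, Complex.mul_im,
      Complex.sub_re, Complex.sub_im]
  · linear_combination hcl
  · linear_combination hcl + ((3 / 2 * κ.x + √3 / 2 * κ.y - 3 / 2) ^ 2 +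
      (κ.y / 2 - √3 / 2 * κ.x - κ.c - √3 / 2) ^ 2) / 4 * hr
  · linear_combination hcl + ((3 / 2 * κ.x + √3 / 2 * κ.y - 3 / 2) ^ 2 +
      (κ.y / 2 - √3 / 2 * κ.x - κ.c - √3 / 2) ^ 2) / 4 * hr

end Core

/-! ### Rigid placements of the kite -/

/-- The integer point `w` describes `s • z` up to an error `ε` in each coordinate. -/
def Close (s ε : ℝ) (z : ℂ) (w : ℤ × ℤ) : Prop :=
  |s * z.re - w.1| ≤ ε ∧ |s * z.im - w.2| ≤ ε

theorem Close.mirror {s ε : ℝ} {z : ℂ} {w : ℤ × ℤ} (h : Close s ε z w) :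
    Close s ε (mirror z) (-w.1, w.2) := by
  refine ⟨?_, h.2⟩
  have := abs_le.1 h.1
  rw [abs_le]
  push_cast [Matchstick.mirror]
  constructor <;> linarith

theorem Close.conj {s ε : ℝ} {z : ℂ} {w : ℤ × ℤ} (h : Close s ε z w) :
    Close s ε (starRingEnd ℂ z) (w.1, -w.2) := by
  refine ⟨h.1, ?_⟩
  have := abs_le.1 h.2
  rw [abs_le]
  push_cast [Complex.conj_im]
  constructor <;> linarith

theorem Near.mirror {z : ℂ} {w w' : ℕ × ℕ} (h : Near z w) (h1 : w.1 + w'.1 = 20000)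
    (h2 : w.2 = w'.2) : Near (mirror z) w' := by
  have h3 := abs_le.1 h.1
  rify at h1
  refine ⟨?_, h2 ▸ h.2⟩
  rw [abs_le]
  simp only [Matchstick.mirror]
  constructor <;> linarith

/-- The grid point `w` describes the image of `z` under a rotation by `y` and a translation
by `t`; the coordinates of `t` and `z` are thousandths, those of `y` are units of `10⁻⁴`. -/
def places (t y z : ℤ × ℤ) (w : ℕ × ℕ) : Bool :=
  decide (|10000 * (t.1 + 10000 - w.1) + (y.1 * z.1 - y.2 * z.2)| ≤ 18000) &&
    decide (|10000 * (t.2 + 10000 - w.2) + (y.1 * z.2 + y.2 * z.1)| ≤ 18000) &&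
    decide (|z.1| ≤ 6000) && decide (|z.2| ≤ 6000)

theorem near_of_places {t y z : ℂ} {t' y' z' : ℤ × ℤ} {w : ℕ × ℕ} (hy : ‖y‖ = 1)
    (ht : Close 1000 0.6 t t') (hy' : Close 10000 1 y y') (hz : Close 1000 0.6 z z')
    (h : places t' y' z' w) : Near (t + y * z) w := by
  simp only [places, Bool.and_eq_true, decide_eq_true_eq] at h
  obtain ⟨⟨⟨h1, h2⟩, h3⟩, h4⟩ := h
  rify at h1 h2 h3 h4
  have hre : |y.re| ≤ 1 := hy ▸ Complex.abs_re_le_norm y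
  have him : |y.im| ≤ 1 := hy ▸ Complex.abs_im_le_norm y
  have prod : ∀ {a b m n : ℝ}, |a| ≤ 1 → |10000 * a - m| ≤ 1 → |1000 * b - n| ≤ 0.6 →
      |n| ≤ 6000 → |1000 * (a * b) - m * n / 10000| ≤ 1.2 := by
    intro a b m n ha hm hb hn
    have key : 1000 * (a * b) - m * n / 10000 =
      a * (1000 * b - n) + (10000 * a - m) * n / 10000 := by ring
    have e1 := mul_le_mul ha hb (abs_nonneg _) zero_le_one
    have e2 := mul_le_mul hm hn (abs_nonneg _) zero_le_one
    rw [← abs_mul, abs_le] at e1 e2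
    rw [key, abs_le]
    constructor <;> linarith [e1.1, e1.2, e2.1, e2.2]
  have p1 := abs_le.1 (prod hre hy'.1 hz.1 h3)
  have p2 := abs_le.1 (prod him hy'.2 hz.2 h4)
  have p3 := abs_le.1 (prod hre hy'.1 hz.2 h4)
  have p4 := abs_le.1 (prod him hy'.2 hz.1 h3)
  have t1 := abs_le.1 ht.1
  have t2 := abs_le.1 ht.2
  rw [abs_le] at h1 h2
  constructor
  · rw [abs_le, Complex.add_re, Complex.mul_re]
    constructor <;> linarith
  · rw [abs_le, Complex.add_im, Complex.mul_im]
    constructor <;> linarith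

/-- Thousandths of `kite j - kite 5`. -/
def kiteGrid : List (ℤ × ℤ) := [
  (-1927, 2267), (-2427, 1401), (-1427, 1401), (-1927, -535), (-3854, 0), (0, 0), (-2177, 433),
  (-2891, -268), (-3141, 701), (-1677, 433), (-964, -268), (-714, 701)]

/-- Thousandths of `reflect (kite j) - kite 5`. -/
def reflectGrid : List (ℤ × ℤ) := [
  (-1927, 2267), (-2701, 1634), (-2862, 2621), (-4693, 1816), (-3854, 0), (-4475, 3804),
  (-3697, 1725), (-4274, 908), (-3278, 817), (-3778, 2218), (-4584, 2810), (-3669, 3212)]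

theorem close_kite {j : ℕ} (hj : j < 12) :
    Close 1000 0.6 (kite j - kite 5) (kiteGrid.getD j 0) := by
  have h1 := abs_le.1 sqrt_three_approx
  have h2 := abs_le.1 sqrt_five_approx
  have h3 := abs_le.1 sqrt_three_mul_sqrt_five_approx
  interval_cases j <;> refine ⟨?_, ?_⟩ <;> rw [abs_le] <;>
    norm_num [kiteGrid, kite] <;> constructor <;> linarith

theorem reflect_re (z : ℂ) : (reflect z).re = (kite 0).re +
    ((14 - 9 * √5) / 38 * (z.re - (kite 0).re) +
      √3 * (6 + 7 * √5) / 38 * (z.im - (kite 0).im)) := by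
  simp only [reflect, Complex.add_re, Complex.mul_re, Complex.conj_re, Complex.conj_im,
    Complex.sub_re, Complex.sub_im]
  ring

theorem reflect_im (z : ℂ) : (reflect z).im = (kite 0).im +
    (√3 * (6 + 7 * √5) / 38 * (z.re - (kite 0).re) -
      (14 - 9 * √5) / 38 * (z.im - (kite 0).im)) := by
  simp only [reflect, Complex.add_im, Complex.mul_im, Complex.conj_re, Complex.conj_im,
    Complex.sub_re, Complex.sub_im]
  ring

theorem close_reflect {j : ℕ} (hj : j < 12) :
    Close 1000 0.6 (reflect (kite j) - kite 5) (reflectGrid.getD j 0) := by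
  have h1 := abs_le.1 sqrt_three_approx
  have h2 := abs_le.1 sqrt_five_approx
  have h3 := abs_le.1 sqrt_three_mul_sqrt_five_approx
  have hr := sqrt_three_sq
  have hf := sqrt_five_sq
  have hrf : √3 ^ 2 * √5 = 3 * √5 := by rw [hr]
  have hrf' : √3 * √5 ^ 2 = 5 * √3 := by rw [hf]; ring
  have hrrff : √3 ^ 2 * √5 ^ 2 = 15 := by rw [hr, hf]; norm_num
  interval_cases j <;> refine ⟨?_, ?_⟩ <;> rw [abs_le] <;>
    norm_num [reflectGrid, reflect_re, reflect_im, kite] <;> constructor <;> linarith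

/-- The displacement from `kite 5` to its mirror image under `reflect`. -/
noncomputable def span : ℂ := reflect (kite 5) - kite 5

theorem span_eq : span =
    ⟨-(159 + 81 * √5) / 76, (111 * √3 + 25 * (√3 * √5)) / 76⟩ := by
  have hr := sqrt_three_sq
  have hf := sqrt_five_sq
  apply Complex.ext <;> simp [span, reflect, kite] <;> ring_nf <;> simp only [hr, hf] <;> ring_nf

theorem span_re_approx : |span.re + 4.475283| ≤ 0.00001 := by
  have := abs_le.1 sqrt_five_approx
  rw [span_eq, abs_le]
  constructor <;> linarith

theorem span_im_approx : |span.im - 3.803713| ≤ 0.00001 := by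
  have := abs_le.1 sqrt_three_approx
  have := abs_le.1 sqrt_three_mul_sqrt_five_approx
  rw [span_eq, abs_le]
  constructor <;> linarith

theorem normSq_span : Complex.normSq span = (687 + 279 * √5) / 38 := by
  rw [span_eq, Complex.normSq_apply]
  ring_nf
  simp only [sqrt_three_sq, sqrt_five_sq]
  ring_nf

theorem normSq_span_approx : |Complex.normSq span - 34.496394| ≤ 0.00001 := by
  have := abs_le.1 sqrt_five_approx
  rw [normSq_span, abs_le]
  constructor <;> linarith

/-- The height over `T` of the point of the imaginary axis at distance `‖span‖` from `T`. -/
noncomputable def rise (T : ℂ) : ℝ := √(Complex.normSq span - T.re ^ 2)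

theorem norm_rise_div {T t s : ℂ} (hT : T.re ^ 2 ≤ 34) (ht : t.re ^ 2 = T.re ^ 2)
    (ht' : t.im ^ 2 = rise T ^ 2) (hs : ‖s‖ = ‖span‖) : ‖t / s‖ = 1 := by
  have h := abs_le.1 normSq_span_approx
  have hsq : ‖t‖ ^ 2 = ‖span‖ ^ 2 := by
    rw [Complex.sq_norm, Complex.sq_norm, Complex.normSq_apply, ← sq, ← sq, ht, ht', rise,
      Real.sq_sqrt (by linarith)]
    ring
  have heq : ‖t‖ = ‖span‖ := (sq_eq_sq₀ (norm_nonneg _) (norm_nonneg _)).1 hsq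
  have hpos : ‖span‖ ≠ 0 := by
    intro h0
    rw [← Complex.sq_norm, h0] at h
    norm_num at h
  rw [norm_div, hs, heq, div_self hpos]

theorem close_div {t s : ℂ} {a b sr si : ℝ} {w : ℤ × ℤ} (hs : ‖s‖ = ‖span‖)
    (hre : |t.re - a| ≤ 0.0002) (him : |t.im - b| ≤ 0.0002) (hsr : |s.re - sr| ≤ 0.00001)
    (hsi : |s.im - si| ≤ 0.00001) (ha : |a| ≤ 6) (hb : |b| ≤ 6) (hsr' : |sr| ≤ 4.5)
    (hsi' : |si| ≤ 4.5) (h1 : |a * sr + b * si - 34.496394 * (w.1 / 10000)| ≤ 0.0013)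
    (h2 : |b * sr - a * si - 34.496394 * (w.2 / 10000)| ≤ 0.0013)
    (hw1 : |(w.1 : ℝ)| ≤ 10000) (hw2 : |(w.2 : ℝ)| ≤ 10000) : Close 10000 1 (t / s) w := by
  have hL := abs_le.1 normSq_span_approx
  have hs2 : Complex.normSq s = Complex.normSq span := by
    rw [← Complex.sq_norm, hs, Complex.sq_norm]
  have hpos : 0 < Complex.normSq span := by linarith
  have solve : ∀ {p q p' q' : ℝ} {m : ℤ}, |p - p'| ≤ 0.001 → |q - q'| ≤ 0.001 →
      |p' + q' - 34.496394 * (m / 10000)| ≤ 0.0013 → |(m : ℝ)| ≤ 10000 →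
      |10000 * ((p + q) / Complex.normSq span) - m| ≤ 1 := by
    intro p q p' q' m hp hq hm hm'
    rw [abs_le] at hp hq hm hm'
    have e : 10000 * ((p + q) / Complex.normSq span) - m =
        (10000 * (p + q) - m * Complex.normSq span) / Complex.normSq span := by
      field_simp
    have hmL := abs_le.1 (abs_mul_sub_mul_le_of (η := 0.1) (a := (m : ℝ)) (a₀ := m) (ε := 0)
      (by simp) normSq_span_approx (by
        have : |(m : ℝ)| ≤ 10000 := abs_le.2 hm'
        linarith))
    rw [e, abs_div, abs_of_pos hpos, div_le_one hpos, abs_le]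
    constructor <;> linarith
  have bnd : ∀ {u v u' v' : ℝ}, |u - u'| ≤ 0.0002 → |v - v'| ≤ 0.00001 → |u'| ≤ 6 → |v'| ≤ 4.5 →
      |u * v - u' * v'| ≤ 0.001 := fun hu hv hu' hv' =>
    abs_mul_sub_mul_le_of hu hv (by linarith)
  have e1 := bnd hre hsr ha hsr'
  have e2 := bnd him hsi hb hsi'
  have e3 := bnd him hsr hb hsr'
  have e4 := bnd hre hsi ha hsi'
  constructor
  · rw [Complex.div_re, hs2, ← add_div]
    exact solve e1 e2 h1 hw1
  · rw [Complex.div_im, hs2, ← sub_div, sub_eq_add_neg]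
    refine solve e3 (q' := -(a * si)) ?_ (by rwa [← sub_eq_add_neg]) hw2
    rwa [neg_sub_neg, abs_sub_comm]

/-! ### The vertices -/

namespace Core

variable (κ : Core)

/-- The vertices of the core. -/
noncomputable def core (i : ℕ) : ℂ := if i < 13 then κ.half i else mirror (κ.half (i - 10))

/-- The label of the mirror image of a vertex in the left half of the core. -/
def _root_.Matchstick.mirrorLabel (i : ℕ) : ℕ := if i < 3 then i else i + 10

/-- The edges of the core. -/
def _root_.Matchstick.coreEdges : List (ℕ × ℕ) :=
  halfEdges ++ halfEdges.map (Prod.map mirrorLabel mirrorLabel) ++ [(8, 18)]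

theorem core_mirrorLabel {i : ℕ} (hi : i < 13) :
    κ.core (mirrorLabel i) = mirror (κ.core i) := by
  by_cases h : i < 3
  · interval_cases i <;> simp [mirrorLabel, core, half, mirror, Complex.ext_iff]
  · simp [mirrorLabel, core, h, hi, show ¬ i + 10 < 13 by lia]

theorem halfEdges_lt : ∀ e ∈ halfEdges, e.1 < 13 ∧ e.2 < 13 := by decide +kernel

theorem norm_coreEdges : ∀ e ∈ coreEdges, ‖κ.core e.1 - κ.core e.2‖ = 1 := by
  have key : ∀ e ∈ halfEdges, ‖κ.core e.1 - κ.core e.2‖ = 1 := fun e he => by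
    simpa [core, halfEdges_lt e he] using κ.norm_halfEdges e he
  simp only [coreEdges, List.forall_mem_append, List.forall_mem_map, List.forall_mem_singleton]
  refine ⟨⟨key, fun e he => ?_⟩, ?_⟩
  · obtain ⟨h1, h2⟩ := halfEdges_lt e he
    rw [Prod.map_fst, Prod.map_snd, κ.core_mirrorLabel h1, κ.core_mirrorLabel h2,
      norm_mirror_sub, key e he]
  · apply norm_sub_eq_of_sq zero_le_one
    norm_num [core, half, mirror]

theorem near_half {i : ℕ} (hi : i < 13) : Near (κ.half i) (grid.getD i 0) := by
  have h1 := abs_le.1 κ.x_approx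
  have h2 := abs_le.1 κ.y_approx
  have h3 := abs_le.1 κ.c_approx
  have h4 := abs_le.1 κ.sqrt_three_mul_x_approx
  have h5 := abs_le.1 κ.sqrt_three_mul_y_approx
  have h6 := abs_le.1 κ.sqrt_three_mul_c_approx
  have h7 := abs_le.1 sqrt_three_approx
  have hr := sqrt_three_sq
  have hx : √3 ^ 2 * κ.x = 3 * κ.x := by rw [hr]
  have hy : √3 ^ 2 * κ.y = 3 * κ.y := by rw [hr]
  interval_cases i <;> refine ⟨?_, ?_⟩ <;> rw [abs_le] <;>
    norm_num [grid, half] <;> constructor <;> linarith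

theorem mirrorLabel_grid : ∀ i < 13, (grid.getD i 0).1 + (grid.getD (mirrorLabel i) 0).1 = 20000 ∧
    (grid.getD i 0).2 = (grid.getD (mirrorLabel i) 0).2 := by decide +kernel

theorem near_core {i : ℕ} (hi : i < 23) : Near (κ.core i) (grid.getD i 0) := by
  by_cases h : i < 13
  · simpa [core, h] using κ.near_half h
  · obtain ⟨j, rfl⟩ : ∃ j, i = j + 10 := ⟨i - 10, by lia⟩
    have hj : mirrorLabel j = j + 10 := by simp [mirrorLabel, show ¬ j < 3 by lia]
    have hg := mirrorLabel_grid j (by lia)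
    rw [hj] at hg
    simpa [core, h] using (κ.near_half (i := j) (by lia)).mirror hg.1 hg.2

/-- The top vertex of the left half where two kites meet. -/
noncomputable def upTip : ℂ :=
  ⟨-(1 + 3 * √5) / 4, √3 * κ.x - κ.y + (√3 * √5 + 3 * √3) / 4⟩

/-- The vertex of the core where the lower kites are attached. -/
noncomputable def lowTip : ℂ := κ.half 9

/-- The rotation of the upper kites. -/
noncomputable def upRot : ℂ := ⟨-κ.upTip.re, rise κ.upTip⟩ / span

/-- The rotation of the lower kites. -/
noncomputable def lowRot : ℂ := ⟨-κ.lowTip.re, -rise κ.lowTip⟩ / starRingEnd ℂ span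

theorem upTip_approx : |κ.upTip.re + 1.92705| ≤ 0.00001 ∧ |κ.upTip.im - 2.648038| ≤ 0.0001 := by
  have h2 := abs_le.1 κ.y_approx
  have h4 := abs_le.1 κ.sqrt_three_mul_x_approx
  have h7 := abs_le.1 sqrt_three_approx
  have h8 := abs_le.1 sqrt_five_approx
  have h9 := abs_le.1 sqrt_three_mul_sqrt_five_approx
  simp only [upTip, abs_le]
  refine ⟨⟨?_, ?_⟩, ?_, ?_⟩ <;> linarith

theorem lowTip_approx : |κ.lowTip.re + 3.296675| ≤ 0.00015 ∧
    |κ.lowTip.im + 1.681282| ≤ 0.00015 := by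
  have h1 := abs_le.1 κ.x_approx
  have h2 := abs_le.1 κ.y_approx
  have h3 := abs_le.1 κ.c_approx
  have h4 := abs_le.1 κ.sqrt_three_mul_x_approx
  have h5 := abs_le.1 κ.sqrt_three_mul_y_approx
  have h6 := abs_le.1 κ.sqrt_three_mul_c_approx
  have h7 := abs_le.1 sqrt_three_approx
  have hr := sqrt_three_sq
  have hx : √3 ^ 2 * κ.x = 3 * κ.x := by rw [hr]
  have hy : √3 ^ 2 * κ.y = 3 * κ.y := by rw [hr]
  simp only [lowTip, half, Complex.add_re, Complex.add_im, Complex.mul_re, Complex.mul_im,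
    Complex.sub_re, Complex.sub_im, abs_le]
  refine ⟨⟨?_, ?_⟩, ?_, ?_⟩ <;> linarith

theorem close_upTip : Close 1000 0.6 κ.upTip (-1927, 2648) := by
  obtain ⟨h1, h2⟩ := κ.upTip_approx
  rw [abs_le] at h1 h2
  simp only [Close, abs_le]
  push_cast
  refine ⟨⟨?_, ?_⟩, ?_, ?_⟩ <;> linarith

theorem close_lowTip : Close 1000 0.6 κ.lowTip (-3297, -1681) := by
  obtain ⟨h1, h2⟩ := κ.lowTip_approx
  rw [abs_le] at h1 h2
  simp only [Close, abs_le]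
  push_cast
  refine ⟨⟨?_, ?_⟩, ?_, ?_⟩ <;> linarith

theorem _root_.Matchstick.rise_approx {T : ℂ} {r h : ℝ} (hT : |T.re + r| ≤ 0.00015) (hr : 0 ≤ r)
    (hr' : r ≤ 4) (hh : 4 ≤ h) (h' : |34.496394 - r ^ 2 - h ^ 2| ≤ 0.0001) :
    |rise T - h| ≤ 0.0002 := by
  have hL := abs_le.1 normSq_span_approx
  have hre := abs_le.1 (abs_mul_sub_mul_le_of (a₀ := -r) (b₀ := -r) (η := 0.0013)
    (by simpa using hT) (by simpa using hT) (by rw [abs_neg, abs_of_nonneg hr]; linarith))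
  rw [abs_le] at h'
  have hsq : rise T ^ 2 = Complex.normSq span - T.re ^ 2 := Real.sq_sqrt (by nlinarith)
  refine abs_sub_le_of_sq (Real.sqrt_nonneg _) (by linarith) (by norm_num) ?_ ?_ <;>
    rw [hsq] <;> nlinarith

theorem rise_upTip_approx : |rise κ.upTip - 5.548231| ≤ 0.0002 :=
  rise_approx (r := 1.92705) (κ.upTip_approx.1.trans (by norm_num)) (by norm_num) (by norm_num)
    (by norm_num) (by norm_num [abs_of_pos, abs_of_neg])

theorem rise_lowTip_approx : |rise κ.lowTip - 4.860898| ≤ 0.0002 :=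
  rise_approx (r := 3.296675) κ.lowTip_approx.1 (by norm_num) (by norm_num)
    (by norm_num) (by norm_num [abs_of_pos, abs_of_neg])

theorem norm_upRot : ‖κ.upRot‖ = 1 := by
  have h := abs_le.1 κ.upTip_approx.1
  exact norm_rise_div (T := κ.upTip) (by nlinarith) (neg_sq _) rfl rfl

theorem norm_lowRot : ‖κ.lowRot‖ = 1 := by
  have h := abs_le.1 κ.lowTip_approx.1
  exact norm_rise_div (T := κ.lowTip) (by nlinarith) (neg_sq _) (neg_sq _) (Complex.norm_conj _)

theorem close_upRot : Close 10000 1 κ.upRot (3618, -9323) := by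
  apply close_div (a := 1.92705) (b := 5.548231) (sr := -4.475283) (si := 3.803713) rfl
  · rw [abs_sub_comm, sub_neg_eq_add, add_comm]
    exact κ.upTip_approx.1.trans (by norm_num)
  · exact κ.rise_upTip_approx
  · simpa using span_re_approx
  · exact span_im_approx
  all_goals norm_num [abs_le]

theorem close_lowRot : Close 10000 1 κ.lowRot (1083, 9941) := by
  apply close_div (a := 3.296675) (b := -4.860898) (sr := -4.475283) (si := -3.803713)
    (Complex.norm_conj _)
  · rw [abs_sub_comm, sub_neg_eq_add, add_comm]
    exact κ.lowTip_approx.1.trans (by norm_num)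
  · rw [neg_sub_neg, abs_sub_comm]
    exact κ.rise_lowTip_approx
  · simpa using span_re_approx
  · rw [Complex.conj_im, neg_sub_neg, abs_sub_comm]
    exact span_im_approx
  all_goals norm_num [abs_le]

/-- The nine placements of the kite. -/
noncomputable def place : ℕ → ℂ → ℂ
  | 0, z => mirror κ.upTip + 1 * starRingEnd ℂ (z - kite 5)
  | 1, z => κ.upTip + κ.upRot * (z - kite 5)
  | 2, z => mirror (κ.upTip + κ.upRot * (z - kite 5))
  | 3, z => κ.upTip + κ.upRot * (reflect z - kite 5)
  | 4, z => mirror (κ.upTip + κ.upRot * (reflect z - kite 5))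
  | 5, z => κ.lowTip + κ.lowRot * starRingEnd ℂ (z - kite 5)
  | 6, z => mirror (κ.lowTip + κ.lowRot * starRingEnd ℂ (z - kite 5))
  | 7, z => κ.lowTip + κ.lowRot * starRingEnd ℂ (reflect z - kite 5)
  | 8, z => mirror (κ.lowTip + κ.lowRot * starRingEnd ℂ (reflect z - kite 5))
  | _, z => z

theorem norm_place_sub (k : ℕ) (z w : ℂ) : ‖κ.place k z - κ.place k w‖ = ‖z - w‖ := by
  have move : ∀ {t y u v : ℂ}, ‖y‖ = 1 → ‖(t + y * (u - kite 5)) - (t + y * (v - kite 5))‖ =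
      ‖u - v‖ := by
    intro t y u v hy
    rw [show (t + y * (u - kite 5)) - (t + y * (v - kite 5)) = y * (u - v) by ring, norm_mul, hy,
      one_mul]
  have move' : ∀ {t y u v : ℂ}, ‖y‖ = 1 → ‖(t + y * starRingEnd ℂ (u - kite 5)) -
      (t + y * starRingEnd ℂ (v - kite 5))‖ = ‖u - v‖ := by
    intro t y u v hy
    rw [show (t + y * starRingEnd ℂ (u - kite 5)) - (t + y * starRingEnd ℂ (v - kite 5)) =
      y * starRingEnd ℂ (u - v) by simp only [map_sub]; ring, norm_mul, hy, one_mul,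
      Complex.norm_conj]
  unfold place
  split <;> simp only [norm_mirror_sub, move κ.norm_upRot, move' κ.norm_lowRot, move' norm_one,
    norm_reflect_sub]

theorem places_kite_grid : ∀ j < 12,
    places (1927, 2648) (10000, 0) ((kiteGrid.getD j 0).1, -(kiteGrid.getD j 0).2)
      (grid.getD (23 + j) 0) ∧
    places (-1927, 2648) (3618, -9323) (kiteGrid.getD j 0) (grid.getD (35 + j) 0) ∧
    places (-1927, 2648) (3618, -9323) (reflectGrid.getD j 0) (grid.getD (59 + j) 0) ∧
    places (-3297, -1681) (1083, 9941) ((kiteGrid.getD j 0).1, -(kiteGrid.getD j 0).2)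
      (grid.getD (83 + j) 0) ∧
    places (-3297, -1681) (1083, 9941) ((reflectGrid.getD j 0).1, -(reflectGrid.getD j 0).2)
      (grid.getD (107 + j) 0) := by decide +kernel

theorem mirror_kite_grid : ∀ j < 12, ∀ i ∈ [35, 59, 83, 107],
    (grid.getD (i + j) 0).1 + (grid.getD (i + 12 + j) 0).1 = 20000 ∧
    (grid.getD (i + j) 0).2 = (grid.getD (i + 12 + j) 0).2 := by decide +kernel

theorem near_place {k j : ℕ} (hk : k < 9) (hj : j < 12) :
    Near (κ.place k (kite j)) (grid.getD (23 + 12 * k + j) 0) := by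
  obtain ⟨c0, c1, c3, c5, c7⟩ := places_kite_grid j hj
  have n0 := near_of_places norm_one κ.close_upTip.mirror
    (by norm_num [Close] : Close 10000 1 1 (10000, 0)) (close_kite hj).conj c0
  have n1 := near_of_places κ.norm_upRot κ.close_upTip κ.close_upRot (close_kite hj) c1
  have n3 := near_of_places κ.norm_upRot κ.close_upTip κ.close_upRot (close_reflect hj) c3
  have n5 := near_of_places κ.norm_lowRot κ.close_lowTip κ.close_lowRot (close_kite hj).conj c5
  have n7 := near_of_places κ.norm_lowRot κ.close_lowTip κ.close_lowRot (close_reflect hj).conj c7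
  have m := mirror_kite_grid j hj
  simp only [List.forall_mem_cons] at m
  obtain ⟨m1, m3, m5, m7, -⟩ := m
  interval_cases k
  · exact n0
  · exact n1
  · exact n1.mirror m1.1 m1.2
  · exact n3
  · exact n3.mirror m3.1 m3.2
  · exact n5
  · exact n5.mirror m5.1 m5.2
  · exact n7
  · exact n7.mirror m7.1 m7.2

/-- The points of all the pieces; points of different pieces may coincide. -/
noncomputable def pos (i : ℕ) : ℂ :=
  if i < 23 then κ.core i else κ.place ((i - 23) / 12) (kite ((i - 23) % 12))

theorem pos_place {k j : ℕ} (hj : j < 12) : κ.pos (23 + 12 * k + j) = κ.place k (kite j) := by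
  rw [pos, if_neg (by lia), show (23 + 12 * k + j - 23) / 12 = k by lia,
    show (23 + 12 * k + j - 23) % 12 = j by lia]

theorem near_pos (i : ℕ) (hi : i < 131) : Near (κ.pos i) (grid.getD i 0) := by
  by_cases h : i < 23
  · simpa [pos, h] using κ.near_core h
  · rw [show i = 23 + 12 * ((i - 23) / 12) + (i - 23) % 12 by lia,
      κ.pos_place (Nat.mod_lt _ (by norm_num))]
    exact κ.near_place (by lia) (Nat.mod_lt _ (by norm_num))

/-! ### The edges -/

/-- The edges of all the pieces. -/
def _root_.Matchstick.pieceEdges : List (ℕ × ℕ) :=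
  coreEdges ++ (List.range 9).flatMap fun k =>
    kiteEdges.map (Prod.map (23 + 12 * k + ·) (23 + 12 * k + ·))

theorem kiteEdges_lt : ∀ e ∈ kiteEdges, e.1 < 12 ∧ e.2 < 12 := by decide +kernel

theorem coreEdges_lt : ∀ e ∈ coreEdges, e.1 < 23 ∧ e.2 < 23 := by decide +kernel

theorem norm_pieceEdges : ∀ e ∈ pieceEdges, ‖κ.pos e.1 - κ.pos e.2‖ = 1 := by
  simp only [pieceEdges, List.forall_mem_append, List.forall_mem_flatMap, List.forall_mem_map]
  refine ⟨fun e he => ?_, fun k _ e he => ?_⟩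
  · simpa [pos, coreEdges_lt e he] using κ.norm_coreEdges e he
  · obtain ⟨h1, h2⟩ := kiteEdges_lt e he
    rw [Prod.map_fst, Prod.map_snd, κ.pos_place h1, κ.pos_place h2, norm_place_sub,
      norm_kiteEdges e he]

theorem _root_.Matchstick.span_ne_zero : span ≠ 0 := by
  intro h
  have := normSq_span_approx
  norm_num [h] at this

theorem pos_glued : ∀ p ∈ glued, κ.pos p.1 = κ.pos p.2 := by
  have hm : κ.half 1 = κ.place 0 (kite 0) := by
    apply Complex.ext <;> simp [place, half, upTip, mirror, kite] <;> ring
  have hu : κ.upRot * (reflect (kite 5) - kite 5) = ⟨-κ.upTip.re, rise κ.upTip⟩ :=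
    div_mul_cancel₀ _ span_ne_zero
  have hl : κ.lowRot * starRingEnd ℂ (reflect (kite 5) - kite 5) =
      ⟨-κ.lowTip.re, -rise κ.lowTip⟩ :=
    div_mul_cancel₀ _ ((map_ne_zero _).2 span_ne_zero)
  have glue : ∀ {k j k' j' : ℕ}, j < 12 → j' < 12 →
      κ.place k (kite j) = κ.place k' (kite j') →
      κ.pos (23 + 12 * k + j) = κ.pos (23 + 12 * k' + j') := fun hj hj' h => by
    rw [κ.pos_place hj, κ.pos_place hj', h]
  have tip : ∀ z : ℂ, κ.pos 9 = z → κ.pos 19 = mirror z := fun z hz => by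
    rw [← hz]; rfl
  have h0 : (0 : ℕ) < 12 := by norm_num
  have h4 : (4 : ℕ) < 12 := by norm_num
  have h5 : (5 : ℕ) < 12 := by norm_num
  simp only [glued, List.forall_mem_cons]
  refine ⟨?_, ?_, ?_, ?_, ?_, ?_, ?_, ?_, ?_, ?_, ?_, ?_, ?_, ?_, ?_, by simp⟩
  · exact (κ.pos_place (k := 0) h0).trans hm.symm
  · refine glue (k := 1) (k' := 0) h5 h4 ?_
    apply Complex.ext <;> simp [place, upTip, mirror, kite]
    ring
  · exact glue (k := 2) (k' := 0) h5 h5 (by simp [place])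
  · exact glue (k := 3) (k' := 1) h0 h0 (by simp only [place, reflect_kite_zero])
  · exact glue (k := 3) (k' := 1) h4 h4 (by simp only [place, reflect_kite_four])
  · exact glue (k := 4) (k' := 2) h0 h0 (by simp only [place, reflect_kite_zero])
  · exact glue (k := 4) (k' := 2) h4 h4 (by simp only [place, reflect_kite_four])
  · exact glue (k := 4) (k' := 3) h5 h5 (by simp [place, hu, mirror, Complex.ext_iff])
  · exact (κ.pos_place (k := 5) h5).trans (by simp [place, pos, core, lowTip])
  · exact (κ.pos_place (k := 6) h5).trans (by simp [place, pos, core, lowTip])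
  · exact glue (k := 7) (k' := 5) h0 h0 (by simp only [place, reflect_kite_zero])
  · exact glue (k := 7) (k' := 5) h4 h4 (by simp only [place, reflect_kite_four])
  · exact glue (k := 8) (k' := 6) h0 h0 (by simp only [place, reflect_kite_zero])
  · exact glue (k := 8) (k' := 6) h4 h4 (by simp only [place, reflect_kite_four])
  · exact glue (k := 8) (k' := 7) h5 h5 (by simp only [place, hl]; simp [mirror, Complex.ext_iff])

/-- The least label of the point labelled `i`. -/
def _root_.Matchstick.leastLabel (i : ℕ) : ℕ := (glued.lookup i).getD i

theorem pos_leastLabel (i : ℕ) : κ.pos (leastLabel i) = κ.pos i := by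
  unfold leastLabel
  cases h : glued.lookup i with
  | none => rfl
  | some j =>
    have hmem : (i, j) ∈ glued := by
      obtain ⟨l₁, l₂, hl, -⟩ := List.lookup_eq_some_iff.1 h
      simp [hl]
    exact (κ.pos_glued _ hmem).symm

theorem sticks_mem_pieceEdges : ∀ e ∈ sticks,
    ∃ p ∈ pieceEdges, (leastLabel p.1 = e.a ∧ leastLabel p.2 = e.b) ∨
      (leastLabel p.1 = e.b ∧ leastLabel p.2 = e.a) := by decide +kernel

theorem realises_sticks : ∀ e ∈ sticks, Realises κ.pos e := by
  intro e he
  obtain ⟨hp, hq⟩ := sticks_grid e he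
  obtain ⟨ha, hb⟩ := sticks_mem_labels e he
  refine ⟨hp ▸ κ.near_pos _ (labels_lt ha), hq ▸ κ.near_pos _ (labels_lt hb), ?_⟩
  obtain ⟨p, hp, ⟨h1, h2⟩ | ⟨h1, h2⟩⟩ := sticks_mem_pieceEdges e he
  · rw [← h1, ← h2, pos_leastLabel, pos_leastLabel, κ.norm_pieceEdges p hp]
  · rw [← h1, ← h2, pos_leastLabel, pos_leastLabel, norm_sub_rev, κ.norm_pieceEdges p hp]

end Core

end Matchstick

/-- There exists a 4-regular matchstick graph with exactly 116 vertices. -/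
theorem exists_fourRegular_matchstick_116 :
    ∃ G : MatchstickGraph, G.IsFourRegular ∧ G.V.card = 116 := by
  obtain ⟨κ⟩ := Matchstick.Core.exists_core
  rw [← Matchstick.length_labels]
  exact Matchstick.exists_fourRegular_of_sticks κ.realises_sticks Matchstick.allCompatible_sticks
    (Matchstick.eq_of_pos_eq κ.near_pos) Matchstick.nodup_labels Matchstick.sticks_mem_labels
    Matchstick.sticks_lt Matchstick.nodup_sticks Matchstick.countP_sticks
end
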